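/- arXiv:math/0701441 — 6 statements merged into one kernel-verified Lean document; each statement's English description precedes it below -/
import Mathlib

section
/- The group Cb₄⁺ is not isomorphic to the pure braid group P₄. Precisely: the subgroup of Aut(F₄) generated by the six automorphisms ε₍ij₎ with 4 ≥ i > j ≥ 1 is not isomorphic (as an abstract group) to the subgroup of Aut(F₄) generated by the six Artin automorphisms a₍rs₎, 1 ≤ r < s ≤ 4. -/
/-!
STATEMENT 0: The group `Cb₄⁺` (the subgroup of `Aut(F₄)` generated by the six
basis-conjugating automorphisms `ε_{ij}` with `i > j`) is not isomorphic to the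
pure braid group `P₄` (the subgroup of `Aut(F₄)` generated by the six Artin
automorphisms `a_{rs}`, `r < s`).
-/

/-- The free group of rank 4, with generators `x₁, x₂, x₃, x₄` indexed by `Fin 4`. -/
abbrev F4 : Type := FreeGroup (Fin 4)

/-- `IsEps φ i j` says that `φ ∈ Aut(F₄)` is the automorphism `ε_{ij}` sending
`x_i ↦ x_j⁻¹ x_i x_j` and fixing all other generators. -/
def IsEps (φ : F4 ≃* F4) (i j : Fin 4) : Prop :=
  ∀ l : Fin 4, φ (FreeGroup.of l) =
    if l = i then (FreeGroup.of j)⁻¹ * FreeGroup.of i * FreeGroup.of j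
    else FreeGroup.of l

/-- `IsArtin φ r s` (for `r < s`) says that `φ ∈ Aut(F₄)` is the Artin generator
`a_{rs}` of the pure braid group, sending `x_r ↦ x_r x_s x_r x_s⁻¹ x_r⁻¹`,
`x_s ↦ x_r x_s x_r⁻¹`, `x_i ↦ [x_r⁻¹,x_s⁻¹] x_i [x_r⁻¹,x_s⁻¹]⁻¹` for `r < i < s`,
and fixing the remaining generators, where `[a,b] = a⁻¹b⁻¹ab`. -/
def IsArtin (φ : F4 ≃* F4) (r s : Fin 4) : Prop :=
  ∀ l : Fin 4, φ (FreeGroup.of l) =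
    if l = r then
      FreeGroup.of r * FreeGroup.of s * FreeGroup.of r * (FreeGroup.of s)⁻¹ *
        (FreeGroup.of r)⁻¹
    else if l = s then
      FreeGroup.of r * FreeGroup.of s * (FreeGroup.of r)⁻¹
    else if r < l ∧ l < s then
      ((FreeGroup.of r)⁻¹⁻¹ * (FreeGroup.of s)⁻¹⁻¹ * (FreeGroup.of r)⁻¹ * (FreeGroup.of s)⁻¹) *
        FreeGroup.of l *
      ((FreeGroup.of r)⁻¹⁻¹ * (FreeGroup.of s)⁻¹⁻¹ * (FreeGroup.of r)⁻¹ * (FreeGroup.of s)⁻¹)⁻¹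
    else FreeGroup.of l

/-- `Cb₄⁺`: the subgroup of `Aut(F₄)` generated by the `ε_{ij}` with `i > j`. -/
def Cb4Plus : Subgroup (MulAut F4) :=
  Subgroup.closure {φ | ∃ i j : Fin 4, j < i ∧ IsEps φ i j}

/-- `P₄`: the subgroup of `Aut(F₄)` generated by the Artin automorphisms
`a_{rs}`, `r < s`. -/
def P4 : Subgroup (MulAut F4) :=
  Subgroup.closure {φ | ∃ r s : Fin 4, r < s ∧ IsArtin φ r s}

/-- A rational nilpotent group of class two: the semidirect product of the abelian normal subgroup
`x = 0` with `ℚ`. Its abelianization has coordinates `x`, `p`, `q`. -/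
@[ext]
structure PairHeis where
  x : ℚ
  p : ℚ
  q : ℚ
  y : ℚ
  z : ℚ

namespace PairHeis

instance : Mul PairHeis :=
  ⟨fun a b => ⟨a.x + b.x, a.p + b.p, a.q + b.q, a.y + b.y + a.x * b.p, a.z + b.z + a.x * b.q⟩⟩

instance : One PairHeis := ⟨⟨0, 0, 0, 0, 0⟩⟩

instance : Inv PairHeis :=
  ⟨fun a => ⟨-a.x, -a.p, -a.q, -a.y + a.x * a.p, -a.z + a.x * a.q⟩⟩

@[simp] lemma mul_x (a b : PairHeis) : (a * b).x = a.x + b.x := rfl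
@[simp] lemma mul_p (a b : PairHeis) : (a * b).p = a.p + b.p := rfl
@[simp] lemma mul_q (a b : PairHeis) : (a * b).q = a.q + b.q := rfl
@[simp] lemma mul_y (a b : PairHeis) : (a * b).y = a.y + b.y + a.x * b.p := rfl
@[simp] lemma mul_z (a b : PairHeis) : (a * b).z = a.z + b.z + a.x * b.q := rfl
@[simp] lemma one_x : (1 : PairHeis).x = 0 := rfl
@[simp] lemma one_p : (1 : PairHeis).p = 0 := rfl
@[simp] lemma one_q : (1 : PairHeis).q = 0 := rfl
@[simp] lemma one_y : (1 : PairHeis).y = 0 := rfl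
@[simp] lemma one_z : (1 : PairHeis).z = 0 := rfl
@[simp] lemma inv_x (a : PairHeis) : a⁻¹.x = -a.x := rfl
@[simp] lemma inv_p (a : PairHeis) : a⁻¹.p = -a.p := rfl
@[simp] lemma inv_q (a : PairHeis) : a⁻¹.q = -a.q := rfl
@[simp] lemma inv_y (a : PairHeis) : a⁻¹.y = -a.y + a.x * a.p := rfl
@[simp] lemma inv_z (a : PairHeis) : a⁻¹.z = -a.z + a.x * a.q := rfl

instance : Group PairHeis :=
  Group.ofLeftAxioms
    (fun a b c => by ext <;> simp <;> ring)
    (fun a => by ext <;> simp)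
    (fun a => by ext <;> simp)

lemma eq_one_of_inv_eq_self {u : PairHeis} (h : u⁻¹ = u) : u = 1 := by
  have hx := congrArg x h
  have hp := congrArg p h
  have hq := congrArg q h
  have hy := congrArg y h
  have hz := congrArg z h
  simp only [inv_x, inv_p, inv_q, inv_y, inv_z] at hx hp hq hy hz
  have hx0 : u.x = 0 := by linarith
  rw [hx0] at hy hz
  ext <;> simp <;> linarith

/-- The linear functional `α x + β p + γ q` on the abelianization. -/
def functional (α β γ : ℚ) : PairHeis →* Multiplicative ℚ where
  toFun a := Multiplicative.ofAdd (α * a.x + β * a.p + γ * a.q)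
  map_one' := by simp
  map_mul' a b := by
    rw [← ofAdd_add]
    congr 1
    simp only [mul_x, mul_p, mul_q]
    ring

lemma functional_eq_one_iff {α β γ : ℚ} {a : PairHeis} :
    functional α β γ a = 1 ↔ α * a.x + β * a.p + γ * a.q = 0 :=
  ofAdd_eq_one

lemma mul_eq_mul_of_commute {a b : PairHeis} (h : a * b = b * a) :
    a.x * b.p = b.x * a.p ∧ a.x * b.q = b.x * a.q := by
  have hy := congrArg y h
  have hz := congrArg z h
  simp only [mul_y, mul_z] at hy hz
  constructor <;> linarith

lemma mul_eq_mul_of_commute_conj {a b c : PairHeis} (h : a * (c * b * c⁻¹) = c * b * c⁻¹ * a) :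
    a.x * b.p = b.x * a.p ∧ a.x * b.q = b.x * a.q := by
  simpa using mul_eq_mul_of_commute h

/-- The element `x = 1`. -/
def c : PairHeis := ⟨1, 0, 0, 0, 0⟩

/-- The elements with only the coordinates `p` and `q` nonzero. -/
def b (s t : ℚ) : PairHeis := ⟨0, s, t, 0, 0⟩

lemma b_mul_b (s t s' t' : ℚ) : b s t * b s' t' = b (s + s') (t + t') := by
  ext <;> simp [b]

lemma b_inv (s t : ℚ) : (b s t)⁻¹ = b (-s) (-t) := by
  ext <;> simp [b]

lemma b_zero : b 0 0 = 1 := rfl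

lemma b_eq_one_of_commute_c {s t : ℚ} (h : b s t * c = c * b s t) : b s t = 1 := by
  have := mul_eq_mul_of_commute h
  simp only [b, c, mul_zero, one_mul] at this
  rw [← this.1, ← this.2, b_zero]

end PairHeis

open PairHeis

/-! ### A homomorphism from `Cb4Plus` to `PairHeis` -/

/-- The action of `PairHeis` on itself by left translation. -/
def leftTranslation : PairHeis →* Equiv.Perm PairHeis :=
  MulAction.toPermHom PairHeis PairHeis

@[simp] lemma leftTranslation_apply (a g : PairHeis) : leftTranslation a g = a * g := rfl

lemma leftTranslation_injective : Function.Injective leftTranslation :=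
  MulAction.toPerm_injective

lemma leftTranslation_b_conj (s t s' t' : ℚ) :
    (leftTranslation (b s t))⁻¹ * (leftTranslation (b s' t') * leftTranslation (b s t)) =
      leftTranslation (b s' t') := by
  rw [← map_mul, ← map_inv, ← map_mul, b_mul_b, b_inv, b_mul_b]
  congr 2 <;> ring

/-- The homomorphism sending `x₁, x₂, x₃` to commuting translations by `b 1 0`, `b 0 1` and
the translation by `c`, and `x₄` to the inversion map conjugated by `v`. -/
def testHom (v : PairHeis) : F4 →* Equiv.Perm PairHeis :=
  FreeGroup.lift
    ![leftTranslation (b 1 0), leftTranslation (b 0 1), leftTranslation c,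
      (leftTranslation v)⁻¹ * Equiv.inv PairHeis * leftTranslation v]

/-- The automorphisms `φ` which act on the homomorphisms `testHom v` by `v ↦ v * u`, up to
conjugation by some `b s t`. -/
def Shifts (φ : MulAut F4) (u : PairHeis) : Prop :=
  ∃ s t : ℚ, ∀ v g, testHom v (φ g) =
    (leftTranslation (b s t))⁻¹ * testHom (v * u) g * leftTranslation (b s t)

lemma Shifts.one : Shifts 1 1 := ⟨0, 0, fun v g => by simp [b_zero]⟩

lemma Shifts.mul {φ ψ : MulAut F4} {u u' : PairHeis} (h : Shifts φ u) (h' : Shifts ψ u') :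
    Shifts (φ * ψ) (u * u') := by
  obtain ⟨s, t, h⟩ := h
  obtain ⟨s', t', h'⟩ := h'
  refine ⟨s' + s, t' + t, fun v g => ?_⟩
  rw [← b_mul_b, MulAut.mul_apply, h, h', map_mul, mul_assoc v]
  group

lemma Shifts.inv {φ : MulAut F4} {u : PairHeis} (h : Shifts φ u) : Shifts φ⁻¹ u⁻¹ := by
  obtain ⟨s, t, h⟩ := h
  refine ⟨-s, -t, fun v g => ?_⟩
  have := h (v * u⁻¹) (φ⁻¹ g)
  rw [MulAut.apply_inv_self, inv_mul_cancel_right] at this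
  rw [← b_inv, map_inv, this]
  group

lemma Shifts.eq_one {u : PairHeis} (h : Shifts 1 u) : u = 1 := by
  obtain ⟨s, t, h⟩ := h
  have hc : b s t * c = c * b s t := by
    have := h 1 (FreeGroup.of 2)
    simp only [testHom, MulAut.one_apply, FreeGroup.lift_apply_of, Matrix.cons_val,
      ← map_inv, ← map_mul] at this
    rw [leftTranslation_injective.eq_iff, mul_assoc, eq_inv_mul_iff_mul_eq] at this
    exact this
  have ht := congrArg (fun f : Equiv.Perm PairHeis => f 1) (h 1 (FreeGroup.of 3))
  rw [b_eq_one_of_commute_c hc] at ht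
  simp only [testHom, MulAut.one_apply, FreeGroup.lift_apply_of, Matrix.cons_val, map_one, inv_one,
    one_mul, mul_one, ← map_inv, Equiv.Perm.mul_apply, leftTranslation_apply, Equiv.inv_apply] at ht
  exact eq_one_of_inv_eq_self (inv_mul_eq_one.mp ht.symm).symm

lemma Shifts.unique {φ : MulAut F4} {u u' : PairHeis} (h : Shifts φ u) (h' : Shifts φ u') :
    u = u' :=
  eq_of_mul_inv_eq_one (Shifts.eq_one (by simpa using h.mul h'.inv))

lemma Shifts.of_generators {φ : MulAut F4} {u : PairHeis} (s t : ℚ)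
    (h : ∀ v l, testHom v (φ (FreeGroup.of l)) = (leftTranslation (b s t))⁻¹ *
      testHom (v * u) (FreeGroup.of l) * leftTranslation (b s t)) : Shifts φ u := by
  refine ⟨s, t, fun v => ?_⟩
  have : (testHom v).comp φ.toMonoidHom =
      (MulAut.conj (leftTranslation (b s t))⁻¹).toMonoidHom.comp (testHom (v * u)) :=
    FreeGroup.ext_hom _ _ fun l => by simpa using h v l
  exact fun g => by simpa using DFunLike.congr_fun this g

/-- The shift by which `ε_{ij}` acts on the homomorphisms `testHom v`. -/
def epsShift : Fin 4 → Fin 4 → PairHeis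
  | 2, 0 => b (-1) 0
  | 2, 1 => b 0 (-1)
  | 3, 0 => b 1 0
  | 3, 1 => b 0 1
  | 3, 2 => c
  | _, _ => 1

lemma IsEps.shifts {φ : MulAut F4} {i j : Fin 4} (hij : j < i) (h : IsEps φ i j) :
    Shifts φ (epsShift i j) := by
  have hinv₁ : b (-1) 0 = (b 1 0)⁻¹ := by simp [b_inv]
  have hinv₂ : b 0 (-1) = (b 0 1)⁻¹ := by simp [b_inv]
  revert h hij
  fin_cases i <;> fin_cases j <;> intro hij h <;> try exact absurd hij (by decide)
  on_goal 2 => apply Shifts.of_generators 1 0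
  on_goal 3 => apply Shifts.of_generators 0 1
  on_goal 1 => apply Shifts.of_generators 0 0
  on_goal 4 => apply Shifts.of_generators 0 0
  on_goal 5 => apply Shifts.of_generators 0 0
  on_goal 6 => apply Shifts.of_generators 0 0
  all_goals
    intro v l
    rw [h]
    fin_cases l <;>
      simp [testHom, epsShift, hinv₁, hinv₂, b_zero, leftTranslation_b_conj, mul_assoc]

lemma exists_shifts {φ : MulAut F4} (h : φ ∈ Cb4Plus) : ∃ u, Shifts φ u := by
  induction h using Subgroup.closure_induction with
  | mem φ h =>
    obtain ⟨i, j, hij, h⟩ := h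
    exact ⟨_, h.shifts hij⟩
  | one => exact ⟨1, Shifts.one⟩
  | mul φ ψ _ _ h h' =>
    obtain ⟨u, h⟩ := h
    obtain ⟨u', h'⟩ := h'
    exact ⟨_, h.mul h'⟩
  | inv φ _ h =>
    obtain ⟨u, h⟩ := h
    exact ⟨_, h.inv⟩

/-- The homomorphism recording the shift of an element of `Cb4Plus`. -/
noncomputable def shiftHom : Cb4Plus →* PairHeis :=
  MonoidHom.mk' (fun φ => (exists_shifts φ.2).choose) fun φ ψ =>
    (exists_shifts (φ * ψ).2).choose_spec.unique
      ((exists_shifts φ.2).choose_spec.mul (exists_shifts ψ.2).choose_spec)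

lemma shiftHom_eq {φ : Cb4Plus} {u : PairHeis} (h : Shifts φ.1 u) : shiftHom φ = u :=
  (exists_shifts φ.2).choose_spec.unique h

/-- The automorphism `ε_{ij}`. -/
def eps (i j : Fin 4) (h : j < i) : MulAut F4 :=
  MonoidHom.toMulEquiv
    (FreeGroup.lift fun l => if l = i then
      (FreeGroup.of j)⁻¹ * FreeGroup.of i * FreeGroup.of j else FreeGroup.of l)
    (FreeGroup.lift fun l => if l = i then
      FreeGroup.of j * FreeGroup.of i * (FreeGroup.of j)⁻¹ else FreeGroup.of l)
    (FreeGroup.ext_hom _ _ fun l => by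
      by_cases hl : l = i <;> simp [hl, h.ne, mul_assoc])
    (FreeGroup.ext_hom _ _ fun l => by
      by_cases hl : l = i <;> simp [hl, h.ne, mul_assoc])

lemma isEps_eps {i j : Fin 4} (h : j < i) : IsEps (eps i j h) i j := fun l => by
  simp [eps]

lemma exists_shiftHom_eq {i j : Fin 4} (h : j < i) : ∃ φ, shiftHom φ = epsShift i j :=
  ⟨⟨eps i j h, Subgroup.subset_closure ⟨i, j, h, isEps_eps h⟩⟩,
    shiftHom_eq ((isEps_eps h).shifts h)⟩

/-! ### Relations in the pure braid group -/

/-- The Artin generator `a_{rs}`. -/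
def artin (r s : Fin 4) (h : r < s) : MulAut F4 :=
  MonoidHom.toMulEquiv
    (FreeGroup.lift fun l =>
      if l = r then
        FreeGroup.of r * FreeGroup.of s * FreeGroup.of r * (FreeGroup.of s)⁻¹ * (FreeGroup.of r)⁻¹
      else if l = s then FreeGroup.of r * FreeGroup.of s * (FreeGroup.of r)⁻¹
      else if r < l ∧ l < s then
        MulAut.conj (FreeGroup.of r * FreeGroup.of s * (FreeGroup.of r)⁻¹ * (FreeGroup.of s)⁻¹)
          (FreeGroup.of l)
      else FreeGroup.of l)
    (FreeGroup.lift fun l =>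
      if l = r then (FreeGroup.of s)⁻¹ * FreeGroup.of r * FreeGroup.of s
      else if l = s then
        (FreeGroup.of s)⁻¹ * (FreeGroup.of r)⁻¹ * FreeGroup.of s * FreeGroup.of r * FreeGroup.of s
      else if r < l ∧ l < s then
        MulAut.conj ((FreeGroup.of s)⁻¹ * (FreeGroup.of r)⁻¹ * FreeGroup.of s * FreeGroup.of r)
          (FreeGroup.of l)
      else FreeGroup.of l)
    (FreeGroup.ext_hom _ _ (by revert r s; decide +kernel))
    (FreeGroup.ext_hom _ _ (by revert r s; decide +kernel))

lemma isArtin_artin {r s : Fin 4} (h : r < s) : IsArtin (artin r s h) r s := by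
  revert r s
  unfold IsArtin
  decide +kernel

lemma IsArtin.eq_artin {φ : MulAut F4} {r s : Fin 4} (h : r < s) (hφ : IsArtin φ r s) :
    φ = artin r s h := by
  have : φ.toMonoidHom = (artin r s h).toMonoidHom :=
    FreeGroup.ext_hom _ _ fun l => (hφ l).trans (isArtin_artin h l).symm
  exact MulEquiv.ext fun g => DFunLike.congr_fun this g

lemma mulAut_ext {φ ψ : MulAut F4} (h : ∀ l, φ (FreeGroup.of l) = ψ (FreeGroup.of l)) : φ = ψ := by
  have : φ.toMonoidHom = ψ.toMonoidHom := FreeGroup.ext_hom _ _ h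
  exact MulEquiv.ext fun g => DFunLike.congr_fun this g

lemma artin_triple {i j k : Fin 4} (hij : i < j) (hjk : j < k) :
    artin i j hij * artin j k hjk * artin i k (hij.trans hjk) =
      artin j k hjk * artin i k (hij.trans hjk) * artin i j hij ∧
    artin i j hij * artin j k hjk * artin i k (hij.trans hjk) =
      artin i k (hij.trans hjk) * artin i j hij * artin j k hjk := by
  constructor <;> apply mulAut_ext <;> revert i j k <;> decide +kernel

lemma artin_comm_01_23 : artin 0 1 (by decide) * artin 2 3 (by decide) =
    artin 2 3 (by decide) * artin 0 1 (by decide) :=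
  mulAut_ext (by decide +kernel)

lemma artin_comm_03_12 : artin 0 3 (by decide) * artin 1 2 (by decide) =
    artin 1 2 (by decide) * artin 0 3 (by decide) :=
  mulAut_ext (by decide +kernel)

lemma artin_comm_02_conj_13 :
    artin 0 2 (by decide) *
      (artin 0 1 (by decide) * artin 1 3 (by decide) * (artin 0 1 (by decide))⁻¹) =
    artin 0 1 (by decide) * artin 1 3 (by decide) * (artin 0 1 (by decide))⁻¹ *
      artin 0 2 (by decide) :=
  mulAut_ext (by decide +kernel)

/-- The Artin generators as elements of `P4`. -/
def artinP4 (r s : Fin 4) (h : r < s) : P4 :=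
  ⟨artin r s h, Subgroup.subset_closure ⟨r, s, h, isArtin_artin h⟩⟩

/-- Two homomorphisms on `P4` agreeing on the Artin generators are equal. -/
lemma P4.hom_ext {M : Type*} [Monoid M] {f g : P4 →* M}
    (h : ∀ r s hrs, f (artinP4 r s hrs) = g (artinP4 r s hrs)) : f = g := by
  refine MonoidHom.eq_of_eqOn_dense Subgroup.closure_closure_coe_preimage ?_
  rintro ⟨φ, hφ⟩ ⟨r, s, hrs, hφ'⟩
  obtain rfl : φ = artin r s hrs := hφ'.eq_artin hrs
  exact h r s hrs

/-! ### Cup products in the first cohomology of `P4` -/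

/-- The linear conditions for the cup product of two classes in `H¹(P4)`, given by their values
on the edges of the complete graph, to vanish. -/
structure CupVanishes (x p : Fin 4 → Fin 4 → ℚ) : Prop where
  disjoint : ∀ i j k l, [i, j, k, l].Nodup → x i j * p k l = x k l * p i j
  triangle : ∀ i j k, [i, j, k].Nodup →
    (x i j + x j k + x i k) * p i j = x i j * (p i j + p j k + p i k)

lemma CupVanishes.sub_mul {x p : Fin 4 → Fin 4 → ℚ} (h : CupVanishes x p) (r : ℚ) :
    CupVanishes x fun i j => p i j - r * x i j where
  disjoint i j k l hn := by linear_combination h.disjoint i j k l hn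
  triangle i j k hn := by linear_combination h.triangle i j k hn

lemma exists_complement : ∀ i j : Fin 4, i ≠ j → ∃ k l, [i, j, k, l].Nodup ∧
    ∀ a, a = i ∨ a = j ∨ a = k ∨ a = l := by
  decide

section

variable {x p q : Fin 4 → Fin 4 → ℚ}

/-- The three classes `x`, `p`, `q` are linearly dependent. -/
def Dependent (x p q : Fin 4 → Fin 4 → ℚ) : Prop :=
  ∃ α β γ : ℚ, ¬ (α = 0 ∧ β = 0 ∧ γ = 0) ∧ ∀ i j, i ≠ j → α * x i j + β * p i j + γ * q i j = 0

lemma dependent_of_normalized (hx : ∀ i j, x i j = x j i) (hp : ∀ i j, p i j = p j i)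
    (hq : ∀ i j, q i j = q j i) (hxp : CupVanishes x p) (hxq : CupVanishes x q) {i j : Fin 4}
    (hij : i ≠ j) (hxij : x i j ≠ 0) (hpij : p i j = 0) (hqij : q i j = 0) :
    Dependent x p q := by
  obtain ⟨k, l, hn, hcover⟩ := exists_complement i j hij
  have vanish : ∀ r : Fin 4 → Fin 4 → ℚ, (∀ i j, r i j = r j i) → CupVanishes x r → r i j = 0 →
      r k l = 0 ∧ r j k = - r i k ∧ r j l = - r i l ∧
      (x i j + x j k + x i k) * r i k = 0 ∧ (x i j + x j l + x i l) * r i l = 0 ∧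
      x i k * r i l + x j l * r i k = 0 ∧ x i l * r i k + x j k * r i l = 0 := by
    intro r hr h hrij
    have h₁ := h.disjoint i j k l hn
    have h₂ := h.disjoint i k j l (by simp at hn ⊢; grind)
    have h₃ := h.disjoint i l j k (by simp at hn ⊢; grind)
    have h₄ := h.triangle i j k (by simp at hn ⊢; grind)
    have h₅ := h.triangle i j l (by simp at hn ⊢; grind)
    have h₆ := h.triangle i k j (by simp at hn ⊢; grind)
    have h₇ := h.triangle i l j (by simp at hn ⊢; grind)
    rw [hx k j, hr k j] at h₆
    rw [hx l j, hr l j] at h₇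
    simp only [hrij, mul_zero, zero_add, zero_eq_mul, mul_eq_zero, hxij, false_or] at h₁ h₄ h₅
    have e₁ : r j k = - r i k := by linarith
    have e₂ : r j l = - r i l := by linarith
    rw [hrij, e₁] at h₆
    rw [hrij, e₂] at h₇
    rw [e₂] at h₂
    rw [e₁] at h₃
    refine ⟨h₁, e₁, e₂, ?_, ?_, ?_, ?_⟩ <;> linarith
  obtain ⟨p₁, p₂, p₃, p₄, p₅, p₆, p₇⟩ := vanish p hp hxp hpij
  obtain ⟨q₁, q₂, q₃, q₄, q₅, q₆, q₇⟩ := vanish q hq hxq hqij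
  have hdet : p i k * q i l = p i l * q i k := by
    by_cases hk : x i j + x j k + x i k = 0
    · by_cases hne : x i k = 0
      · have : x j k ≠ 0 := by
          rintro h
          simp [h, hne, hxij] at hk
        refine mul_left_cancel₀ this ?_
        linear_combination p i k * q₇ - q i k * p₇
      · refine mul_left_cancel₀ hne ?_
        linear_combination p i k * q₆ - q i k * p₆
    · simp [(mul_eq_zero.mp p₄).resolve_left hk, (mul_eq_zero.mp q₄).resolve_left hk]
  have hcomb : ∀ β γ : ℚ, ¬ (β = 0 ∧ γ = 0) → β * p i k + γ * q i k = 0 →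
      β * p i l + γ * q i l = 0 → Dependent x p q := by
    intro β γ hne hk hl
    refine ⟨0, β, γ, by simpa using hne, fun a b hab => ?_⟩
    have hsymm : ∀ a b, β * p a b + γ * q a b = β * p b a + γ * q b a := fun a b => by
      rw [hp a b, hq a b]
    have hjk : β * p j k + γ * q j k = 0 := by rw [p₂, q₂]; linarith
    have hjl : β * p j l + γ * q j l = 0 := by rw [p₃, q₃]; linarith
    have hij' : β * p i j + γ * q i j = 0 := by rw [hpij, hqij]; ring
    have hkl : β * p k l + γ * q k l = 0 := by rw [p₁, q₁]; ring
    rw [zero_mul, zero_add]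
    rcases hcover a with rfl | rfl | rfl | rfl <;> rcases hcover b with rfl | rfl | rfl | rfl <;>
      first
      | exact absurd rfl hab
      | assumption
      | (rw [hsymm]; assumption)
  by_cases h₁ : q i k = 0 ∧ p i k = 0
  · by_cases h₂ : q i l = 0 ∧ p i l = 0
    · exact hcomb 1 0 (by simp) (by simp [h₁]) (by simp [h₂])
    · exact hcomb (q i l) (-p i l) (by simpa using h₂) (by simp [h₁]) (by ring)
  · exact hcomb (q i k) (-p i k) (by simpa using h₁) (by ring) (by linear_combination -hdet)

lemma dependent_of_cupVanishes (hx : ∀ i j, x i j = x j i) (hp : ∀ i j, p i j = p j i)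
    (hq : ∀ i j, q i j = q j i) (hxp : CupVanishes x p) (hxq : CupVanishes x q) :
    Dependent x p q := by
  by_cases h : ∀ i j, i ≠ j → x i j = 0
  · exact ⟨1, 0, 0, by simp, fun i j hij => by simp [h i j hij]⟩
  · push Not at h
    obtain ⟨i, j, hij, hxij⟩ := h
    obtain ⟨α, β, γ, hne, hsum⟩ := dependent_of_normalized hx
      (fun a b => by rw [hp a b, hx a b]) (fun a b => by rw [hq a b, hx a b])
      (hxp.sub_mul (p i j / x i j)) (hxq.sub_mul (q i j / x i j)) hij hxij
      (by field_simp; ring) (by field_simp; ring)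
    refine ⟨α - β * (p i j / x i j) - γ * (q i j / x i j), β, γ, ?_, fun a b hab => ?_⟩
    · rintro ⟨hα, rfl, rfl⟩
      exact hne (by simpa using hα)
    · linear_combination hsum a b hab

end

/-- Extend a function on ordered pairs to a symmetric function. -/
def symmExt (n : ∀ i j : Fin 4, i < j → ℚ) (i j : Fin 4) : ℚ :=
  if h : i < j then n i j h else if h : j < i then n j i h else 0

lemma symmExt_comm (n : ∀ i j : Fin 4, i < j → ℚ) (i j : Fin 4) :
    symmExt n i j = symmExt n j i := by
  unfold symmExt
  rcases lt_trichotomy i j with h | rfl | h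
  · simp [h, h.not_gt]
  · rfl
  · simp [h, h.not_gt]

lemma symmExt_of_lt {n : ∀ i j : Fin 4, i < j → ℚ} {i j : Fin 4} (h : i < j) :
    symmExt n i j = n i j h := dif_pos h

lemma symmExt_cupVanishes {x p : ∀ i j : Fin 4, i < j → ℚ}
    (h₁ : x 0 1 (by decide) * p 2 3 (by decide) = x 2 3 (by decide) * p 0 1 (by decide))
    (h₂ : x 0 2 (by decide) * p 1 3 (by decide) = x 1 3 (by decide) * p 0 2 (by decide))
    (h₃ : x 0 3 (by decide) * p 1 2 (by decide) = x 1 2 (by decide) * p 0 3 (by decide))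
    (htri : ∀ i j k (hij : i < j) (hjk : j < k),
      (x j k hjk + x i k (hij.trans hjk)) * p i j hij =
        x i j hij * (p j k hjk + p i k (hij.trans hjk)) ∧
      (x i j hij + x j k hjk) * p i k (hij.trans hjk) =
        x i k (hij.trans hjk) * (p i j hij + p j k hjk)) :
    CupVanishes (symmExt x) (symmExt p) where
  disjoint i j k l hn := by
    fin_cases i <;> fin_cases j <;> fin_cases k <;> fin_cases l <;>
      first
      | exact absurd hn (by decide)
      | (simp [symmExt]; linarith)
  triangle i j k hn := by
    have := htri 0 1 2 (by decide) (by decide)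
    have := htri 0 1 3 (by decide) (by decide)
    have := htri 0 2 3 (by decide) (by decide)
    have := htri 1 2 3 (by decide) (by decide)
    fin_cases i <;> fin_cases j <;> fin_cases k <;>
      first
      | exact absurd hn (by decide)
      | (simp [symmExt]; linarith)

/-- The image of a homomorphism from `P4` to `PairHeis` lies in the kernel of a nonzero functional. -/
lemma exists_functional_vanishing (f : P4 →* PairHeis) :
    ∃ α β γ : ℚ, ¬ (α = 0 ∧ β = 0 ∧ γ = 0) ∧ ∀ g, functional α β γ (f g) = 1 := by
  have h₁ := mul_eq_mul_of_commute (a := f (artinP4 0 1 (by decide)))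
    (b := f (artinP4 2 3 (by decide))) (by
      rw [← map_mul, ← map_mul]
      exact congrArg f (Subtype.ext artin_comm_01_23))
  have h₂ := mul_eq_mul_of_commute_conj (a := f (artinP4 0 2 (by decide)))
    (b := f (artinP4 1 3 (by decide))) (c := f (artinP4 0 1 (by decide))) (by
      simp only [← map_mul, ← map_inv]
      exact congrArg f (Subtype.ext artin_comm_02_conj_13))
  have h₃ := mul_eq_mul_of_commute (a := f (artinP4 0 3 (by decide)))
    (b := f (artinP4 1 2 (by decide))) (by
      rw [← map_mul, ← map_mul]
      exact congrArg f (Subtype.ext artin_comm_03_12))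
  have htri : ∀ i j k (hij : i < j) (hjk : j < k), _ ∧ _ := fun i j k hij hjk =>
    And.intro
      (mul_eq_mul_of_commute (a := f (artinP4 j k hjk) * f (artinP4 i k (hij.trans hjk)))
        (b := f (artinP4 i j hij)) (by
          simp only [← map_mul]
          exact congrArg f (Subtype.ext ((artin_triple hij hjk).1.symm.trans (mul_assoc _ _ _)))))
      (mul_eq_mul_of_commute (a := f (artinP4 i j hij) * f (artinP4 j k hjk))
        (b := f (artinP4 i k (hij.trans hjk))) (by
          simp only [← map_mul]
          exact congrArg f (Subtype.ext ((artin_triple hij hjk).2.trans (mul_assoc _ _ _)))))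
  obtain ⟨α, β, γ, hne, hsum⟩ := dependent_of_cupVanishes
    (symmExt_comm fun i j h => (f (artinP4 i j h)).x)
    (symmExt_comm fun i j h => (f (artinP4 i j h)).p)
    (symmExt_comm fun i j h => (f (artinP4 i j h)).q)
    (symmExt_cupVanishes h₁.1 h₂.1 h₃.1 fun i j k hij hjk =>
      ⟨(htri i j k hij hjk).1.1, (htri i j k hij hjk).2.1⟩)
    (symmExt_cupVanishes h₁.2 h₂.2 h₃.2 fun i j k hij hjk =>
      ⟨(htri i j k hij hjk).1.2, (htri i j k hij hjk).2.2⟩)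
  have : (functional α β γ).comp f = 1 := P4.hom_ext fun r s h => by
    have := hsum r s h.ne
    rw [symmExt_of_lt h, symmExt_of_lt h, symmExt_of_lt h] at this
    exact functional_eq_one_iff.mpr this
  exact ⟨α, β, γ, hne, fun g => DFunLike.congr_fun this g⟩

/-- The groups `Cb₄⁺` and `P₄` are not isomorphic. -/
theorem Cb4Plus_not_isomorphic_P4 : ¬ Nonempty (Cb4Plus ≃* P4) := by
  rintro ⟨e⟩
  obtain ⟨α, β, γ, hne, hvanish⟩ :=
    exists_functional_vanishing (shiftHom.comp e.symm.toMonoidHom)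
  have hgen : ∀ i j : Fin 4, j < i → functional α β γ (epsShift i j) = 1 := fun i j h => by
    obtain ⟨φ, hφ⟩ := exists_shiftHom_eq h
    simpa [hφ] using hvanish (e φ)
  have h₁ := functional_eq_one_iff.mp (hgen 3 2 (by decide))
  have h₂ := functional_eq_one_iff.mp (hgen 3 0 (by decide))
  have h₃ := functional_eq_one_iff.mp (hgen 3 1 (by decide))
  simp only [epsShift, b, c] at h₁ h₂ h₃
  exact hne ⟨by linarith, by linarith, by linarith⟩
end

section
/- The center of Cb₄⁺ is the infinite cyclic group generated by the element ε₂₁ ε₃₁ ε₄₁, and Cb₄⁺ is the internal direct product of its center with the subgroup G generated by ε₃₁, ε₃₂, ε₄₁, ε₄₂, ε₄₃. -/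
namespace FreeGroup

theorem of_commute_of_iff {α : Type*} {a b : α} : Commute (of a) (of b) ↔ a = b := by
  classical
  refine ⟨fun h => ?_, fun h => h ▸ Commute.refl _⟩
  by_contra hab
  have := congrArg toWord h.eq
  simp [toWord_mul, reduce.cons, hab] at this

theorem isCyclic_of_forall_mul_comm {H : Type*} [Group H] [IsFreeGroup H]
    (hH : ∀ a b : H, a * b = b * a) : IsCyclic H := by
  have hgen : ∀ a b : IsFreeGroup.Generators H, a = b := fun a b =>
    of_commute_of_iff.1 <| show of a * of b = of b * of a from
      (IsFreeGroup.toFreeGroup H).symm.injective <| by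
        rw [_root_.map_mul, _root_.map_mul]
        exact hH _ _
  have hF : IsCyclic (FreeGroup (IsFreeGroup.Generators H)) := by
    rcases isEmpty_or_nonempty (IsFreeGroup.Generators H) with _ | ⟨⟨c⟩⟩
    · infer_instance
    · refine ⟨of c, fun g => ?_⟩
      have hle : Subgroup.closure (Set.range of) ≤ Subgroup.zpowers (of c) := by
        rw [Subgroup.closure_le]
        rintro _ ⟨a, rfl⟩
        exact hgen c a ▸ Subgroup.mem_zpowers _
      exact hle (closure_range_of _ ▸ Subgroup.mem_top g)
  exact (MulEquiv.isCyclic (IsFreeGroup.toFreeGroup H)).2 hF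

/-- The centralizer of a free generator is the cyclic group it generates. -/
theorem mem_zpowers_of_of_commute {α : Type*} {a : α} {g : FreeGroup α}
    (h : Commute g (of a)) : g ∈ Subgroup.zpowers (of a) := by
  classical
  let H : Subgroup (FreeGroup α) := Subgroup.closure {g, of a}
  have hcomm : ∀ u v : H, u * v = v * u := by
    have hc : IsMulCommutative H := Subgroup.isMulCommutative_closure <| by
      rintro x (rfl | rfl) y (rfl | rfl)
      exacts [rfl, h, h.symm, rfl]
    exact fun u v => hc.is_comm.comm u v
  obtain ⟨c, hc⟩ := (isCyclic_of_forall_mul_comm hcomm).exists_generator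
  obtain ⟨m, hm⟩ := hc ⟨g, Subgroup.subset_closure (by simp)⟩
  obtain ⟨k, hk⟩ := hc ⟨of a, Subgroup.subset_closure (by simp)⟩
  replace hm : (c : FreeGroup α) ^ m = g := congrArg Subtype.val hm
  replace hk : (c : FreeGroup α) ^ k = of a := congrArg Subtype.val hk
  let e : FreeGroup α →* Multiplicative ℤ :=
    lift fun b => if b = a then Multiplicative.ofAdd 1 else 1
  have he := congrArg (fun x => Multiplicative.toAdd (e x)) hk
  simp only [map_zpow, toAdd_zpow, e, lift_apply_of, if_true, toAdd_ofAdd, smul_eq_mul] at he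
  rw [← hm]
  rcases Int.isUnit_iff.1 (IsUnit.of_mul_eq_one _ he) with rfl | rfl
  · rw [← hk]
    exact ⟨m, by simp⟩
  · rw [← hk]
    exact ⟨-m, by simp⟩

/-- The subgroup of the free group generated by the generators in `s`. -/
def subgroupOf {α : Type*} (s : Set α) : Subgroup (FreeGroup α) :=
  Subgroup.closure (of '' s)

theorem of_mem_subgroupOf {α : Type*} {s : Set α} {a : α} (h : a ∈ s) : of a ∈ subgroupOf s :=
  Subgroup.subset_closure ⟨a, h, rfl⟩

theorem eq_one_of_commute_of_mem_subgroupOf {α : Type*} {s : Set α} {a : α} (ha : a ∉ s)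
    {g : FreeGroup α} (h : Commute g (of a)) (hg : g ∈ subgroupOf s) : g = 1 := by
  classical
  obtain ⟨k, rfl⟩ := mem_zpowers_of_of_commute h
  let e : FreeGroup α →* Multiplicative ℤ :=
    lift fun b => if b = a then Multiplicative.ofAdd 1 else 1
  have hker : subgroupOf s ≤ e.ker := by
    rw [subgroupOf, Subgroup.closure_le]
    rintro _ ⟨b, hb, rfl⟩
    have : b ≠ a := fun hba => ha (hba ▸ hb)
    simp [e, MonoidHom.mem_ker, this]
  have hk := congrArg Multiplicative.toAdd (MonoidHom.mem_ker.1 (hker hg))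
  simp only [map_zpow, toAdd_zpow, e, lift_apply_of, if_true, toAdd_ofAdd, smul_eq_mul,
    toAdd_one, mul_one] at hk
  simp [hk]

theorem eq_one_of_commute_of_of {α : Type*} {a b : α} (hab : a ≠ b) {g : FreeGroup α}
    (ha : Commute g (of a)) (hb : Commute g (of b)) : g = 1 := by
  obtain ⟨k, rfl⟩ := mem_zpowers_of_of_commute ha
  exact eq_one_of_commute_of_mem_subgroupOf (s := {a}) (by simpa using hab.symm) hb
    (zpow_mem (of_mem_subgroupOf (Set.mem_singleton a)) k)

end FreeGroup

section

open FreeGroup (of subgroupOf of_mem_subgroupOf eq_one_of_commute_of_mem_subgroupOf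
  eq_one_of_commute_of_of)

theorem IsEps.apply_self {φ : F4 ≃* F4} {i j : Fin 4} (h : IsEps φ i j) :
    φ (of i) = (of j)⁻¹ * of i * of j := by
  simp [h i]

theorem IsEps.apply_of_ne {φ : F4 ≃* F4} {i j l : Fin 4} (h : IsEps φ i j) (hl : l ≠ i) :
    φ (of l) = of l := by
  simp [h l, hl]

theorem MulAut.ext_of {φ ψ : MulAut F4} (h : ∀ l, φ (of l) = ψ (of l)) : φ = ψ :=
  MulEquiv.toMonoidHom_injective (FreeGroup.ext_hom _ _ h)

theorem IsEps.unique {φ ψ : MulAut F4} {i j : Fin 4} (h : IsEps φ i j) (h' : IsEps ψ i j) :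
    φ = ψ :=
  MulAut.ext_of fun l => (h l).trans (h' l).symm

theorem IsEps.inv_apply_of_ne {φ : MulAut F4} {i j l : Fin 4} (h : IsEps φ i j) (hl : l ≠ i) :
    φ⁻¹ (of l) = of l :=
  (MulEquiv.symm_apply_eq φ).2 (h.apply_of_ne hl).symm

theorem IsEps.inv_apply_self {φ : MulAut F4} {i j : Fin 4} (h : IsEps φ i j) (hij : j ≠ i) :
    φ⁻¹ (of i) = of j * of i * (of j)⁻¹ :=
  (MulEquiv.symm_apply_eq φ).2 <| by
    simp only [map_mul, map_inv, h.apply_self, h.apply_of_ne hij]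
    group

theorem map_mem_subgroupOf {s : Set (Fin 4)} {f : F4 →* F4}
    (h : ∀ l ∈ s, f (of l) ∈ subgroupOf s) {w : F4} (hw : w ∈ subgroupOf s) :
    f w ∈ subgroupOf s := by
  have : subgroupOf s ≤ (subgroupOf s).comap f := by
    conv_lhs => rw [subgroupOf]
    rw [Subgroup.closure_le]
    rintro _ ⟨l, hl, rfl⟩
    exact h l hl
  exact this hw

theorem map_eq_self_of_mem_subgroupOf {s : Set (Fin 4)} {f : F4 →* F4}
    (h : ∀ l ∈ s, f (of l) = of l) {w : F4} (hw : w ∈ subgroupOf s) : f w = w := by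
  have : subgroupOf s ≤ f.eqLocus (MonoidHom.id F4) := by
    rw [subgroupOf, Subgroup.closure_le]
    rintro _ ⟨l, hl, rfl⟩
    exact h l hl
  exact this hw

/-- Automorphisms sending each `x_i` to a conjugate of `x_i` by an element of the subgroup
generated by the `x_j` with `j < i`. -/
def IsTriangular (φ : MulAut F4) : Prop :=
  ∀ i, ∃ w ∈ FreeGroup.subgroupOf (Set.Iio i),
    φ (FreeGroup.of i) = w⁻¹ * FreeGroup.of i * w

theorem IsTriangular.map_mem {φ : MulAut F4} (h : IsTriangular φ) {i : Fin 4} {w : F4}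
    (hw : w ∈ subgroupOf (Set.Iio i)) : φ w ∈ subgroupOf (Set.Iio i) := by
  refine map_mem_subgroupOf (f := φ.toMonoidHom) (fun l hl => ?_) hw
  obtain ⟨v, hv, hφ⟩ := h l
  have hv' : v ∈ subgroupOf (Set.Iio i) :=
    Subgroup.closure_mono (Set.image_mono (Set.Iio_subset_Iio (le_of_lt hl))) hv
  change φ (of l) ∈ _
  rw [hφ]
  exact mul_mem (mul_mem (inv_mem hv') (of_mem_subgroupOf hl)) hv'

theorem IsTriangular.one : IsTriangular 1 := fun _ => ⟨1, one_mem _, by simp⟩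

theorem IsTriangular.mul {φ ψ : MulAut F4} (hφ : IsTriangular φ) (hψ : IsTriangular ψ) :
    IsTriangular (φ * ψ) := by
  intro i
  obtain ⟨v, hv, hv'⟩ := hφ i
  obtain ⟨w, hw, hw'⟩ := hψ i
  refine ⟨v * φ w, mul_mem hv (hφ.map_mem hw), ?_⟩
  simp only [MulAut.mul_apply, hw', map_mul, map_inv, hv']
  group

theorem IsEps.isTriangular {φ : MulAut F4} {i j : Fin 4} (hji : j < i) (h : IsEps φ i j) :
    IsTriangular φ := by
  intro l
  by_cases hl : l = i
  · subst hl
    exact ⟨of j, of_mem_subgroupOf hji, h.apply_self⟩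
  · exact ⟨1, one_mem _, by simp [h.apply_of_ne hl]⟩

theorem IsEps.isTriangular_inv {φ : MulAut F4} {i j : Fin 4} (hji : j < i) (h : IsEps φ i j) :
    IsTriangular φ⁻¹ := by
  intro l
  by_cases hl : l = i
  · subst hl
    exact ⟨(of j)⁻¹, inv_mem (of_mem_subgroupOf hji), by
      rw [h.inv_apply_self hji.ne, inv_inv]⟩
  · exact ⟨1, one_mem _, by rw [h.inv_apply_of_ne hl]; simp⟩

theorem isTriangular_of_mem_Cb4Plus {φ : MulAut F4} (h : φ ∈ Cb4Plus) : IsTriangular φ := by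
  induction h using Subgroup.closure_induction_left with
  | one => exact .one
  | mul_left x hx y _ ih =>
    obtain ⟨i, j, hji, hx⟩ := hx
    exact (hx.isTriangular hji).mul ih
  | inv_mul_cancel x hx y _ ih =>
    obtain ⟨i, j, hji, hx⟩ := hx
    exact (hx.isTriangular_inv hji).mul ih

theorem IsTriangular.apply_of_zero {φ : MulAut F4} (h : IsTriangular φ) :
    φ (of 0) = of 0 := by
  obtain ⟨w, hw, hφ⟩ := h 0
  have : w = 1 := by
    have hs : Set.Iio (0 : Fin 4) = ∅ := by ext l; simp
    simpa [subgroupOf, hs] using hw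
  simpa [this] using hφ

theorem commute_of_commute_eps {φ ε : MulAut F4} {i j : Fin 4} {w : F4} (hji : j < i)
    (hε : IsEps ε i j) (hcomm : Commute φ ε) (hj : φ (of j) = of j)
    (hw : w ∈ subgroupOf (Set.Iio i)) (hφ : φ (of i) = w⁻¹ * of i * w) :
    Commute w (of j) := by
  have hεw : ε w = w := map_eq_self_of_mem_subgroupOf (f := ε.toMonoidHom)
    (fun l hl => hε.apply_of_ne (ne_of_lt hl)) hw
  have key : φ (ε (of i)) = ε (φ (of i)) := DFunLike.congr_fun hcomm.eq (of i)
  simp only [hε.apply_self, hφ, map_mul, map_inv, hj, hεw] at key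
  have hone : of j * w * (of j)⁻¹ * w⁻¹ = 1 := by
    refine eq_one_of_commute_of_mem_subgroupOf (s := Set.Iio i) (a := i) (by simp) ?_
      (mul_mem (mul_mem (mul_mem (of_mem_subgroupOf hji) hw) (inv_mem (of_mem_subgroupOf hji)))
        (inv_mem hw))
    calc of j * w * (of j)⁻¹ * w⁻¹ * of i
        = of j * w * ((of j)⁻¹ * (w⁻¹ * of i * w) * of j) * (of j)⁻¹ * w⁻¹ := by group
      _ = of i * (of j * w * (of j)⁻¹ * w⁻¹) := by rw [key]; group
  exact (mul_inv_eq_iff_eq_mul.1 (mul_inv_eq_one.1 hone)).symm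

theorem apply_of_eq_self_of_commute_eps {φ ε ε' : MulAut F4} {i j j' : Fin 4}
    (hT : IsTriangular φ) (hjj : j ≠ j') (hji : j < i) (hji' : j' < i)
    (hε : IsEps ε i j) (hε' : IsEps ε' i j') (hcomm : Commute φ ε) (hcomm' : Commute φ ε')
    (hj : φ (of j) = of j) (hj' : φ (of j') = of j') : φ (of i) = of i := by
  obtain ⟨w, hw, hφ⟩ := hT i
  have : w = 1 := eq_one_of_commute_of_of hjj (commute_of_commute_eps hji hε hcomm hj hw hφ)
    (commute_of_commute_eps hji' hε' hcomm' hj' hw hφ)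
  simpa [this] using hφ

end

/-- The center of `Cb₄⁺` is infinite cyclic, generated by `ε₂₁ ε₃₁ ε₄₁`, and `Cb₄⁺`
is the internal direct product of its center with the subgroup generated by
`ε₃₁, ε₃₂, ε₄₁, ε₄₂, ε₄₃` (i.e. that subgroup is normal and is a lattice
complement of the center). -/
theorem center_Cb4Plus_and_direct_product
    (e21 e31 e41 e32 e42 e43 : MulAut F4)
    (h21 : IsEps e21 1 0) (h31 : IsEps e31 2 0) (h41 : IsEps e41 3 0)
    (h32 : IsEps e32 2 1) (h42 : IsEps e42 3 1) (h43 : IsEps e43 3 2)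
    (m21 : e21 ∈ Cb4Plus) (m31 : e31 ∈ Cb4Plus) (m41 : e41 ∈ Cb4Plus)
    (m32 : e32 ∈ Cb4Plus) (m42 : e42 ∈ Cb4Plus) (m43 : e43 ∈ Cb4Plus) :
    letI z : Cb4Plus := ⟨e21 * e31 * e41, mul_mem (mul_mem m21 m31) m41⟩
    letI G : Subgroup Cb4Plus :=
      Subgroup.closure {(⟨e31, m31⟩ : Cb4Plus), ⟨e32, m32⟩, ⟨e41, m41⟩, ⟨e42, m42⟩, ⟨e43, m43⟩}
    Subgroup.center Cb4Plus = Subgroup.zpowers z ∧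
    ¬ IsOfFinOrder z ∧
    G.Normal ∧
    IsCompl (Subgroup.center Cb4Plus) G := by
  let z : Cb4Plus := ⟨e21 * e31 * e41, mul_mem (mul_mem m21 m31) m41⟩
  let G : Subgroup Cb4Plus :=
    Subgroup.closure {(⟨e31, m31⟩ : Cb4Plus), ⟨e32, m32⟩, ⟨e41, m41⟩, ⟨e42, m42⟩, ⟨e43, m43⟩}
  change Subgroup.center Cb4Plus = Subgroup.zpowers z ∧ ¬ IsOfFinOrder z ∧ G.Normal ∧
    IsCompl (Subgroup.center Cb4Plus) G
  have hz : ∀ x : F4, (z : MulAut F4) x = (FreeGroup.of 0)⁻¹ * x * FreeGroup.of 0 := by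
    have : (z : MulAut F4) = MulAut.conj (FreeGroup.of 0)⁻¹ := MulAut.ext_of fun l => by
      change e21 (e31 (e41 (FreeGroup.of l))) = _
      fin_cases l <;>
        simp [h21 _, h31 _, h41 _]
    intro x
    simp [this]
  have hzk : ∀ (k : ℤ) (x : F4), ((z ^ k : Cb4Plus) : MulAut F4) x =
      (FreeGroup.of 0 ^ k)⁻¹ * x * FreeGroup.of 0 ^ k := by
    have : (z : MulAut F4) = MulAut.conj (FreeGroup.of 0)⁻¹ := by
      ext1 x
      simp [hz]
    intro k x
    simp [this, ← map_zpow]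
  have hT : ∀ φ : Cb4Plus, IsTriangular (φ : MulAut F4) := fun φ => isTriangular_of_mem_Cb4Plus φ.2
  have hzc : z ∈ Subgroup.center Cb4Plus := by
    refine Subgroup.mem_center_iff.2 fun φ => Subtype.ext (MulEquiv.ext fun x => ?_)
    change (φ : MulAut F4) ((z : MulAut F4) x) = (z : MulAut F4) ((φ : MulAut F4) x)
    simp [hz, (hT φ).apply_of_zero]
  have hcenter : Subgroup.center Cb4Plus = Subgroup.zpowers z := by
    refine le_antisymm (fun φ hφ => ?_) (by simpa using hzc)
    obtain ⟨w, hw, hφw⟩ := hT φ 1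
    obtain ⟨k, rfl⟩ : ∃ k : ℤ, FreeGroup.of 0 ^ k = w := by
      have hs : Set.Iio (1 : Fin 4) = {0} := by ext l; simp
      rw [hs, FreeGroup.subgroupOf, Set.image_singleton, ← Subgroup.zpowers_eq_closure] at hw
      exact hw
    let ψ : Cb4Plus := φ * z ^ (-k)
    have hψ : ψ ∈ Subgroup.center Cb4Plus := mul_mem hφ (zpow_mem hzc _)
    have hc : ∀ (e : MulAut F4), e ∈ Cb4Plus → Commute (ψ : MulAut F4) e := fun e he =>
      (congrArg Subtype.val (Subgroup.mem_center_iff.1 hψ ⟨e, he⟩)).symm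
    have h0 : (ψ : MulAut F4) (FreeGroup.of 0) = FreeGroup.of 0 := (hT ψ).apply_of_zero
    have h1 : (ψ : MulAut F4) (FreeGroup.of 1) = FreeGroup.of 1 := by
      change (φ : MulAut F4) (((z ^ (-k) : Cb4Plus) : MulAut F4) (FreeGroup.of 1)) = _
      rw [hzk]
      simp only [map_mul, map_inv, map_zpow, (hT φ).apply_of_zero, hφw]
      group
    have h2 : (ψ : MulAut F4) (FreeGroup.of 2) = FreeGroup.of 2 :=
      apply_of_eq_self_of_commute_eps (hT ψ) (by decide) (by decide) (by decide) h31 h32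
        (hc _ m31) (hc _ m32) h0 h1
    have h3 : (ψ : MulAut F4) (FreeGroup.of 3) = FreeGroup.of 3 :=
      apply_of_eq_self_of_commute_eps (hT ψ) (by decide) (by decide) (by decide) h41 h42
        (hc _ m41) (hc _ m42) h0 h1
    have hone : ψ = 1 := Subtype.ext <| MulAut.ext_of fun l => by
      fin_cases l
      exacts [h0, h1, h2, h3]
    exact ⟨k, (by simpa [ψ, mul_inv_eq_one] using hone : φ = z ^ k).symm⟩
  have hzfix : ∀ k : ℤ, ((z ^ k : Cb4Plus) : MulAut F4) (FreeGroup.of 1) = FreeGroup.of 1 →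
      k = 0 := by
    intro k hk
    rw [hzk] at hk
    have : (FreeGroup.of 0 : F4) ^ k = 1 := by
      refine FreeGroup.eq_one_of_commute_of_mem_subgroupOf (s := {0}) (a := (1 : Fin 4)) (by simp) ?_
        (zpow_mem (FreeGroup.of_mem_subgroupOf (Set.mem_singleton 0)) k)
      rw [mul_assoc, inv_mul_eq_iff_eq_mul] at hk
      exact hk.symm
    exact (IsMulTorsionFree.zpow_eq_one_iff_right (FreeGroup.of_ne_one _)).1 this
  have hGfix : ∀ g ∈ G, (g : MulAut F4) (FreeGroup.of 1) = FreeGroup.of 1 := by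
    have : G ≤ (MulAction.stabilizer (MulAut F4) (FreeGroup.of 1 : F4)).comap Cb4Plus.subtype := by
      rw [Subgroup.closure_le]
      rintro _ (rfl | rfl | rfl | rfl | rfl)
      exacts [h31.apply_of_ne (by decide), h32.apply_of_ne (by decide),
        h41.apply_of_ne (by decide), h42.apply_of_ne (by decide), h43.apply_of_ne (by decide)]
    exact fun g hg => this hg
  have hsup : Subgroup.center Cb4Plus ⊔ G = ⊤ := by
    have hG : ∀ {e : Cb4Plus}, e ∈ G → e ∈ Subgroup.center Cb4Plus ⊔ G :=
      fun h => Subgroup.mem_sup_right h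
    have k31 : (⟨e31, m31⟩ : Cb4Plus) ∈ G := Subgroup.subset_closure (by simp)
    have k32 : (⟨e32, m32⟩ : Cb4Plus) ∈ G := Subgroup.subset_closure (by simp)
    have k41 : (⟨e41, m41⟩ : Cb4Plus) ∈ G := Subgroup.subset_closure (by simp)
    have k42 : (⟨e42, m42⟩ : Cb4Plus) ∈ G := Subgroup.subset_closure (by simp)
    have k43 : (⟨e43, m43⟩ : Cb4Plus) ∈ G := Subgroup.subset_closure (by simp)
    have k21 : (⟨e21, m21⟩ : Cb4Plus) ∈ Subgroup.center Cb4Plus ⊔ G := by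
      have : (⟨e21, m21⟩ : Cb4Plus) = z * ⟨e41, m41⟩⁻¹ * ⟨e31, m31⟩⁻¹ := Subtype.ext <| by
        change e21 = e21 * e31 * e41 * e41⁻¹ * e31⁻¹
        group
      rw [this]
      exact mul_mem (mul_mem (Subgroup.mem_sup_left hzc) (hG (inv_mem k41))) (hG (inv_mem k31))
    have hle : Cb4Plus ≤ (Subgroup.center Cb4Plus ⊔ G).map Cb4Plus.subtype := by
      conv_lhs => rw [Cb4Plus]
      rw [Subgroup.closure_le]
      rintro φ ⟨i, j, hji, hφ⟩
      fin_cases i <;> fin_cases j <;> first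
        | exact absurd hji (by decide)
        | exact ⟨_, k21, h21.unique hφ⟩
        | exact ⟨_, hG k31, h31.unique hφ⟩
        | exact ⟨_, hG k32, h32.unique hφ⟩
        | exact ⟨_, hG k41, h41.unique hφ⟩
        | exact ⟨_, hG k42, h42.unique hφ⟩
        | exact ⟨_, hG k43, h43.unique hφ⟩
    refine top_unique fun φ _ => ?_
    obtain ⟨ψ, hψ, hψφ⟩ := hle φ.2
    exact Subtype.ext hψφ ▸ hψ
  refine ⟨hcenter, fun hfin => ?_, ⟨fun g hg x => ?_⟩, ?_, codisjoint_iff.2 hsup⟩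
  · obtain ⟨n, hn, hzn⟩ := isOfFinOrder_iff_pow_eq_one.1 hfin
    have := hzfix n (by simp [hzn])
    omega
  · obtain ⟨c, hc, h, hh, rfl⟩ := Subgroup.mem_sup_of_normal_left.1 (hsup.ge (Subgroup.mem_top x))
    have : c * h * g * (c * h)⁻¹ = h * g * h⁻¹ := by
      rw [← Subgroup.mem_center_iff.1 hc h, mul_assoc h, ← Subgroup.mem_center_iff.1 hc g]
      group
    rw [this]
    exact mul_mem (mul_mem hh hg) (inv_mem hh)
  · rw [Subgroup.disjoint_def]
    intro x hx hxG
    rw [hcenter] at hx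
    obtain ⟨k, rfl⟩ := hx
    have := hzfix k (hGfix _ hxG)
    simp [this]
end

section
/- The group G presented by generators e₃₁, e₃₂, e₄₁, e₄₂, e₄₃ with relations e₃₁⁻¹e₄₁e₃₁ = e₄₁, e₃₁⁻¹e₄₂e₃₁ = e₄₂, e₃₁⁻¹e₄₃e₃₁ = e₄₁e₄₃e₄₁⁻¹, e₃₂⁻¹e₄₁e₃₂ = e₄₁, e₃₂⁻¹e₄₂e₃₂ = e₄₂, e₃₂⁻¹e₄₃e₃₂ = e₄₂e₄₃e₄₂⁻¹ is not isomorphic to the group H presented by generators a₁₃, a₂₃, a₁₄, a₂₄, a₃₄ with relations a₁₃a₁₄a₁₃⁻¹ = a₃₄⁻¹a₁₄a₃₄, a₁₃⁻¹a₂₄a₁₃ = [a₁₄⁻¹, a₃₄⁻¹] a₂₄ [a₃₄⁻¹, a₁₄⁻¹], a₂₃⁻¹a₁₄a₂₃ = a₁₄, a₂₃a₂₄a₂₃⁻¹ = a₃₄⁻¹a₂₄a₃₄, a₁₃⁻¹a₃₄a₁₃ = a₁₄a₃₄a₁₄⁻¹, a₂₃⁻¹a₃₄a₂₃ = a₂₄a₃₄a₂₄⁻¹.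 -/
/-!
STATEMENT 2: The group `G = ⟨e₃₁,e₃₂,e₄₁,e₄₂,e₄₃ | …⟩` is not isomorphic to the
group `H = ⟨a₁₃,a₂₃,a₁₄,a₂₄,a₃₄ | …⟩`, with the presentations listed in the paper.
-/

/-- The commutator convention of the paper: `[a,b] = a⁻¹ b⁻¹ a b`. -/
def pcomm {α : Type*} [Group α] (a b : α) : α := a⁻¹ * b⁻¹ * a * b

namespace Stmt2

/-- Free generators for `G`: `e₃₁, e₃₂, e₄₁, e₄₂, e₄₃` are `ge 0, …, ge 4`. -/
abbrev ge (i : Fin 5) : FreeGroup (Fin 5) := FreeGroup.of i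

noncomputable abbrev e31 := ge 0
noncomputable abbrev e32 := ge 1
noncomputable abbrev e41 := ge 2
noncomputable abbrev e42 := ge 3
noncomputable abbrev e43 := ge 4

/-- The relators of the presentation of `G` (each relation `l = r` is recorded as
the relator `l * r⁻¹`). -/
noncomputable def relsG : Set (FreeGroup (Fin 5)) :=
  { e31⁻¹ * e41 * e31 * e41⁻¹,
    e31⁻¹ * e42 * e31 * e42⁻¹,
    e31⁻¹ * e43 * e31 * (e41 * e43 * e41⁻¹)⁻¹,
    e32⁻¹ * e41 * e32 * e41⁻¹,
    e32⁻¹ * e42 * e32 * e42⁻¹,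
    e32⁻¹ * e43 * e32 * (e42 * e43 * e42⁻¹)⁻¹ }

/-- Free generators for `H`: `a₁₃, a₂₃, a₁₄, a₂₄, a₃₄` are `ga 0, …, ga 4`. -/
abbrev ga (i : Fin 5) : FreeGroup (Fin 5) := FreeGroup.of i

noncomputable abbrev a13 := ga 0
noncomputable abbrev a23 := ga 1
noncomputable abbrev a14 := ga 2
noncomputable abbrev a24 := ga 3
noncomputable abbrev a34 := ga 4

/-- The relators of the presentation of `H` (each relation `l = r` is recorded as
the relator `l * r⁻¹`), where `[a,b] = a⁻¹b⁻¹ab`. -/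
noncomputable def relsH : Set (FreeGroup (Fin 5)) :=
  { a13 * a14 * a13⁻¹ * (a34⁻¹ * a14 * a34)⁻¹,
    a13⁻¹ * a24 * a13 * (pcomm a14⁻¹ a34⁻¹ * a24 * pcomm a34⁻¹ a14⁻¹)⁻¹,
    a23⁻¹ * a14 * a23 * a14⁻¹,
    a23 * a24 * a23⁻¹ * (a34⁻¹ * a24 * a34)⁻¹,
    a13⁻¹ * a34 * a13 * (a14 * a34 * a14⁻¹)⁻¹,
    a23⁻¹ * a34 * a23 * (a24 * a34 * a24⁻¹)⁻¹ }

/-- The presented group `G`. -/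
noncomputable abbrev G := PresentedGroup relsG

/-- The presented group `H`. -/
noncomputable abbrev H := PresentedGroup relsH

/-- The Heisenberg group over a commutative ring `R`, with a point standing for the
upper unitriangular matrix with entries `x`, `y` above the diagonal and `z` in the corner. -/
@[ext]
structure Heis (R : Type*) where
  /-- The first coordinate of the abelianization. -/
  x : R
  /-- The second coordinate of the abelianization. -/
  y : R
  /-- The central coordinate. -/
  z : R

namespace Heis

variable {R : Type*} [CommRing R]

instance : Mul (Heis R) := ⟨fun g h => ⟨g.x + h.x, g.y + h.y, g.z + h.z + g.x * h.y⟩⟩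

instance : One (Heis R) := ⟨⟨0, 0, 0⟩⟩

instance : Inv (Heis R) := ⟨fun g => ⟨-g.x, -g.y, -g.z + g.x * g.y⟩⟩

@[simp] lemma mul_x (g h : Heis R) : (g * h).x = g.x + h.x := rfl
@[simp] lemma mul_y (g h : Heis R) : (g * h).y = g.y + h.y := rfl
@[simp] lemma mul_z (g h : Heis R) : (g * h).z = g.z + h.z + g.x * h.y := rfl
@[simp] lemma one_x : (1 : Heis R).x = 0 := rfl
@[simp] lemma one_y : (1 : Heis R).y = 0 := rfl
@[simp] lemma one_z : (1 : Heis R).z = 0 := rfl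
@[simp] lemma inv_x (g : Heis R) : g⁻¹.x = -g.x := rfl
@[simp] lemma inv_y (g : Heis R) : g⁻¹.y = -g.y := rfl
@[simp] lemma inv_z (g : Heis R) : g⁻¹.z = -g.z + g.x * g.y := rfl

instance : Group (Heis R) :=
  Group.ofLeftAxioms
    (fun g h k => by ext <;> simp <;> ring)
    (fun g => by ext <;> simp)
    (fun g => by ext <;> simp)

end Heis

/-- Values on the five generators of `H` of two classes in `H¹(H; R)`
whose cup product vanishes. -/
def CupVanishes {R : Type*} [CommRing R] (s t : Fin 5 → R) : Prop :=
  s 0 * t 3 = s 3 * t 0 ∧ s 1 * t 2 = s 2 * t 1 ∧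
  s 0 * t 2 - s 2 * t 0 = s 2 * t 4 - s 4 * t 2 ∧
  s 0 * t 4 - s 4 * t 0 = s 4 * t 2 - s 2 * t 4 ∧
  s 1 * t 3 - s 3 * t 1 = s 3 * t 4 - s 4 * t 3 ∧
  s 1 * t 4 - s 4 * t 1 = s 4 * t 3 - s 3 * t 4

instance {R : Type*} [CommRing R] [DecidableEq R] (s t : Fin 5 → R) :
    Decidable (CupVanishes s t) := by
  unfold CupVanishes; infer_instance

lemma cupVanishes_of_relsH {R : Type*} [CommRing R] (f : FreeGroup (Fin 5) →* Heis R)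
    (hf : ∀ r ∈ relsH, f r = 1) :
    CupVanishes (fun i => (f (FreeGroup.of i)).x) (fun i => (f (FreeGroup.of i)).y) := by
  have key : ∀ r ∈ relsH, (f r).z = 0 := fun r hr => by rw [hf r hr, Heis.one_z]
  simp only [relsH, Set.mem_insert_iff, Set.mem_singleton_iff, forall_eq_or_imp, forall_eq,
    pcomm, map_mul, map_inv, Heis.mul_x, Heis.mul_y, Heis.mul_z, Heis.inv_x, Heis.inv_y,
    Heis.inv_z] at key
  obtain ⟨h1, h2, h3, h4, h5, h6⟩ := key
  refine ⟨?_, ?_, ?_, ?_, ?_, ?_⟩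
  · linear_combination -h2
  · linear_combination -h3
  · linear_combination h1
  · linear_combination -h5
  · linear_combination h4
  · linear_combination -h6

lemma cupVanishes_of_hom {R : Type*} [CommRing R] (f : H →* Heis R) :
    CupVanishes (fun i => (f (PresentedGroup.of i)).x) (fun i => (f (PresentedGroup.of i)).y) :=
  cupVanishes_of_relsH (f.comp (PresentedGroup.mk relsH)) fun r hr => by
    rw [MonoidHom.comp_apply, PresentedGroup.one_of_mem hr, map_one]

lemma eq_of_cupVanishes : ∀ s t : Fin 5 → ZMod 2, CupVanishes s t → s = 0 ∨ t = 0 ∨ s = t ∨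
    ∀ u, CupVanishes s u → u = 0 ∨ s = u ∨ t = u ∨ s + t = u := by
  decide +kernel

/-- Over `ZMod 2`, the annihilator of a nonzero class in `H¹(H)` under the cup product
has dimension at most two. -/
lemma dependent_of_cupVanishes {s t u : Fin 5 → ZMod 2}
    (ht : CupVanishes s t) (hu : CupVanishes s u) :
    ∃ k l m : ZMod 2, (k ≠ 0 ∨ l ≠ 0 ∨ m ≠ 0) ∧ ∀ i, k * s i + l * t i + m * u i = 0 := by
  rcases eq_of_cupVanishes s t ht with rfl | rfl | rfl | h
  · exact ⟨1, 0, 0, by simp, by simp⟩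
  · exact ⟨0, 1, 0, by simp, by simp⟩
  · exact ⟨1, 1, 0, by simp, by simp [CharTwo.add_self_eq_zero]⟩
  rcases h u hu with rfl | rfl | rfl | rfl
  · exact ⟨0, 0, 1, by simp, by simp⟩
  · exact ⟨1, 0, 1, by simp, by simp [CharTwo.add_self_eq_zero]⟩
  · exact ⟨0, 1, 1, by simp, by simp [CharTwo.add_self_eq_zero]⟩
  · exact ⟨1, 1, 1, by simp, by simp [CharTwo.add_self_eq_zero]⟩

/-- Five elements of a group that satisfy the relations of `G`, rewritten as commutations,
are the images of the generators under a homomorphism. -/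
lemma exists_hom_G {K : Type*} [Group K] (x y a b c : K)
    (hxa : Commute x a) (hxb : Commute x b) (hya : Commute y a) (hyb : Commute y b)
    (hc : Commute (x * a) c) (hc' : Commute (y * b) c) :
    ∃ f : G →* K, ∀ i, f (PresentedGroup.of i) = ![x, y, a, b, c] i := by
  have h : ∀ r ∈ relsG, FreeGroup.lift ![x, y, a, b, c] r = 1 := by
    have conj {g h k : K} (e : h * g = g * k) : g⁻¹ * h * g * k⁻¹ = 1 := by
      rw [mul_assoc g⁻¹ h g, e]; group
    have conj' {g h k : K} (e : Commute (g * h) k) : k * g = g * (h * k * h⁻¹) := by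
      rw [← mul_assoc, ← mul_assoc, eq_mul_inv_iff_mul_eq, e.eq, mul_assoc]
    simp only [relsG, Set.mem_insert_iff, Set.mem_singleton_iff, forall_eq_or_imp, forall_eq,
      map_mul, map_inv, FreeGroup.lift_apply_of]
    exact ⟨conj hxa.eq.symm, conj hxb.eq.symm, conj (conj' hc), conj hya.eq.symm,
      conj hyb.eq.symm, conj (conj' hc')⟩
  exact ⟨PresentedGroup.toGroup h, fun i => PresentedGroup.toGroup.of h⟩

/-- The presented groups `G` and `H` are not isomorphic. -/
theorem G_not_isomorphic_H : ¬ Nonempty (G ≃* H) := by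
  rintro ⟨φ⟩
  let X : Heis (ZMod 2) := ⟨1, 0, 0⟩
  let Y : Heis (ZMod 2) := ⟨0, 1, 0⟩
  have hY : Y * Y = 1 := by ext <;> decide
  obtain ⟨p, hp⟩ := exists_hom_G Y 1 Y 1 X (.refl _) (.one_right _) (.one_left _) (.refl _)
    (by rw [hY]; exact .one_left _) (by rw [mul_one]; exact .one_left _)
  obtain ⟨q, hq⟩ := exists_hom_G 1 Y 1 Y X (.refl _) (.one_left _) (.one_right _) (.refl _)
    (by rw [mul_one]; exact .one_left _) (by rw [hY]; exact .one_left _)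
  -- a linear relation between coordinates of `p` and `q` can be checked on generators
  let comb (k l m : ZMod 2) : G →* Multiplicative (ZMod 2) :=
    MonoidHom.mk' (fun g => .ofAdd (k * (p g).x + l * (p g).y + m * (q g).y)) fun g h => by
      rw [← ofAdd_add]
      congr 1
      simp only [map_mul, Heis.mul_x, Heis.mul_y]
      ring
  have hpq : ∀ g, (p g).x = (q g).x := by
    let px : G →* Multiplicative (ZMod 2) :=
      MonoidHom.mk' (fun g => .ofAdd ((p g).x)) fun g h => by rw [← ofAdd_add]; simp
    let qx : G →* Multiplicative (ZMod 2) :=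
      MonoidHom.mk' (fun g => .ofAdd ((q g).x)) fun g h => by rw [← ofAdd_add]; simp
    have : px = qx := PresentedGroup.ext fun i => by
      simp only [px, qx, MonoidHom.mk'_apply, hp, hq]
      fin_cases i <;> rfl
    exact fun g => Multiplicative.ofAdd.injective (DFunLike.congr_fun this g)
  have hP := cupVanishes_of_hom (p.comp φ.symm.toMonoidHom)
  have hQ := cupVanishes_of_hom (q.comp φ.symm.toMonoidHom)
  simp only [MonoidHom.comp_apply, ← hpq] at hP hQ
  obtain ⟨k, l, m, hne, hrel⟩ := dependent_of_cupVanishes hP hQ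
  have hcomb : (comb k l m).comp φ.symm.toMonoidHom = 1 :=
    PresentedGroup.ext fun i => congrArg Multiplicative.ofAdd (hrel i)
  have hzero : ∀ g, k * (p g).x + l * (p g).y + m * (q g).y = 0 := fun g => by
    have h : k * (p (φ.symm (φ g))).x + l * (p (φ.symm (φ g))).y + m * (q (φ.symm (φ g))).y = 0 :=
      Multiplicative.ofAdd.injective (DFunLike.congr_fun hcomb (φ g))
    rwa [φ.symm_apply_apply] at h
  have h2 := hzero (PresentedGroup.of 2)
  have h3 := hzero (PresentedGroup.of 3)
  have h4 := hzero (PresentedGroup.of 4)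
  simp [hp, hq, X, Y] at h2 h3 h4
  simp [h2, h3, h4] at hne

end Stmt2
end

section
/- If a group G is not nilpotent-by-abelian-by-finite, then the automorphism group Aut(G * ℤ) of the free product of G with the infinite cyclic group is not linear. -/
/-!
STATEMENT 3: If a group `G` is not nilpotent-by-abelian-by-finite, then
`Aut(G * ℤ)` is not linear.
-/

/-- `L` has a faithful finite-dimensional representation over the field `K`. -/
def HasFaithfulRep (L : Type*) [Group L] (K : Type) [Field K] : Prop :=
  ∃ (n : ℕ) (f : L →* GL (Fin n) K), Function.Injective f

/-- A group `L` is linear if it embeds in `GL(n, K)` for some field `K` and some `n`. -/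
def IsLinear (L : Type*) [Group L] : Prop :=
  ∃ (K : Type) (inst : Field K), @HasFaithfulRep L _ K inst

/-- A group `G` is nilpotent-by-abelian-by-finite if there are subgroups
`N ⊴ M ⊴ G` with `N` nilpotent, `M/N` abelian (equivalently `[M,M] ≤ N`)
and `G/M` finite. -/
def IsNilpotentByAbelianByFinite (G : Type*) [Group G] : Prop :=
  ∃ M : Subgroup G, M.Normal ∧ Finite (G ⧸ M) ∧
    ∃ N : Subgroup M, N.Normal ∧ Group.IsNilpotent N ∧ commutator M ≤ N

/-- The free product `G * ℤ` of `G` with the infinite cyclic group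
(realized as the free group on one generator). -/
abbrev FreeProdZ (G : Type*) [Group G] : Type _ := Monoid.Coprod G (FreeGroup Unit)

open scoped Topology commutatorElement

section RegularFunctions

variable {G K : Type*} [Group G] [Field K] {n : ℕ}

/-- The algebra of functions on `G` generated by the matrix coefficients of `g ↦ b g` and
`g ↦ b g⁻¹`. -/
def regularFunctions (b : G →* Matrix (Fin n) (Fin n) K) : Subalgebra K (G → K) :=
  Algebra.adjoin K (Set.range (fun (p : Fin n × Fin n) g => b g p.1 p.2) ∪
    Set.range (fun (p : Fin n × Fin n) g => b g⁻¹ p.1 p.2))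

variable (b : G →* Matrix (Fin n) (Fin n) K)

instance regularFunctions.isNoetherianRing : IsNoetherianRing (regularFunctions b) := by
  have : Algebra.FiniteType K (regularFunctions b) := by
    rw [← Subalgebra.fg_iff_finiteType]
    exact Subalgebra.fg_def.2 ⟨_, (Set.finite_range _).union (Set.finite_range _), rfl⟩
  exact Algebra.FiniteType.isNoetherianRing K _

/-- A matrix-valued function on `G` is regular if its entries are regular functions. -/
def IsRegularMatrix (F : G → Matrix (Fin n) (Fin n) K) : Prop :=
  ∀ i j, (fun g => F g i j) ∈ regularFunctions b

variable {b}

theorem isRegularMatrix_self : IsRegularMatrix b (fun g => b g) := fun i j =>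
  Algebra.subset_adjoin (Or.inl ⟨(i, j), rfl⟩)

theorem isRegularMatrix_inv : IsRegularMatrix b (fun g => b g⁻¹) := fun i j =>
  Algebra.subset_adjoin (Or.inr ⟨(i, j), rfl⟩)

theorem isRegularMatrix_const (A : Matrix (Fin n) (Fin n) K) :
    IsRegularMatrix b (fun _ => A) := fun i j =>
  (regularFunctions b).algebraMap_mem (A i j)

theorem IsRegularMatrix.mul {F F' : G → Matrix (Fin n) (Fin n) K}
    (hF : IsRegularMatrix b F) (hF' : IsRegularMatrix b F') :
    IsRegularMatrix b (fun g => F g * F' g) := fun i j => by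
  have : (fun g => (F g * F' g) i j) = ∑ k, (fun g => F g i k) * (fun g => F' g k j) := by
    ext g
    simp [Matrix.mul_apply]
  rw [this]
  exact sum_mem fun k _ => mul_mem (hF i k) (hF' k j)

theorem IsRegularMatrix.comp_mem {φ : G → G} (h : IsRegularMatrix b (fun g => b (φ g)))
    (h' : IsRegularMatrix b (fun g => b (φ g)⁻¹)) {f : G → K} (hf : f ∈ regularFunctions b) :
    f ∘ φ ∈ regularFunctions b := by
  induction hf using Algebra.adjoin_induction with
  | mem f hf =>
    obtain ⟨p, rfl⟩ | ⟨p, rfl⟩ := hf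
    exacts [h _ _, h' _ _]
  | algebraMap r => exact (regularFunctions b).algebraMap_mem r
  | add f₁ f₂ _ _ h₁ h₂ => exact add_mem h₁ h₂
  | mul f₁ f₂ _ _ h₁ h₂ => exact mul_mem h₁ h₂

theorem IsRegularMatrix.charpoly_coeff_mem {F : G → Matrix (Fin n) (Fin n) K}
    (hF : IsRegularMatrix b F) (k : ℕ) :
    (fun g => (F g).charpoly.coeff k) ∈ regularFunctions b := by
  let F' : Matrix (Fin n) (Fin n) (regularFunctions b) := fun i j => ⟨_, hF i j⟩
  have : (fun g => (F g).charpoly.coeff k) = (F'.charpoly.coeff k : G → K) := by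
    ext g
    let ev : regularFunctions b →+* K := (Pi.evalRingHom _ g).comp (regularFunctions b).subtype
    change _ = ev (F'.charpoly.coeff k)
    rw [← Polynomial.coeff_map, ← Matrix.charpoly_map]
    rfl
  rw [this]
  exact Subtype.prop _

variable (b)

/-- The point of the spectrum of the algebra of regular functions given by evaluation at `g`. -/
def evalPoint (g : G) : PrimeSpectrum (regularFunctions b) :=
  ⟨RingHom.ker ((Pi.evalRingHom (fun _ : G => K) g).comp (regularFunctions b).subtype),
    RingHom.ker_isPrime _⟩

/-- The Zariski topology on `G` defined by the representation `b`. -/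
@[reducible] def zariskiTopology : TopologicalSpace G :=
  TopologicalSpace.induced (evalPoint b) inferInstance

theorem isClosed_zariskiTopology {f : G → K} (hf : f ∈ regularFunctions b) (c : K) :
    IsClosed[zariskiTopology b] {g | f g = c} := by
  let f' : regularFunctions b := ⟨f, hf⟩ - algebraMap K _ c
  refine isClosed_induced_iff.2 ⟨_, PrimeSpectrum.isClosed_zeroLocus {f'}, ?_⟩
  ext g
  rw [Set.mem_preimage, PrimeSpectrum.mem_zeroLocus, Set.singleton_subset_iff]
  exact RingHom.mem_ker.trans sub_eq_zero

theorem continuous_zariskiTopology {φ : G → G}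
    (h : ∀ f ∈ regularFunctions b, f ∘ φ ∈ regularFunctions b) :
    @Continuous _ _ (zariskiTopology b) (zariskiTopology b) φ := by
  let := zariskiTopology b
  refine continuous_induced_rng.2 ?_
  refine PrimeSpectrum.isTopologicalBasis_basic_opens.continuous_iff.2 ?_
  rintro _ ⟨f, rfl⟩
  have := (isClosed_zariskiTopology b (h f f.2) 0).isOpen_compl
  convert this using 1
  rfl

theorem noetherianSpace_zariskiTopology :
    @TopologicalSpace.NoetherianSpace G (zariskiTopology b) := by
  let := zariskiTopology b
  exact Topology.IsInducing.noetherianSpace (i := evalPoint b) ⟨rfl⟩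

end RegularFunctions

section ConnectedComponent

open TopologicalSpace

variable {G : Type*} [Group G]

theorem finite_connectedComponents_of_noetherianSpace (X : Type*) [TopologicalSpace X]
    [NoetherianSpace X] : Finite (ConnectedComponents X) := by
  have : Finite (irreducibleComponents X) := NoetherianSpace.finite_irreducibleComponents.to_subtype
  have hne (s : irreducibleComponents X) : (s : Set X).Nonempty := s.2.1.1
  refine Finite.of_surjective (α := irreducibleComponents X)
    (fun s => ConnectedComponents.mk (hne s).some) fun q => ?_
  obtain ⟨x, rfl⟩ := ConnectedComponents.surjective_coe q
  refine ⟨⟨irreducibleComponent x, irreducibleComponent_mem_irreducibleComponents x⟩, ?_⟩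
  exact ConnectedComponents.coe_eq_coe'.2
    (isIrreducible_irreducibleComponent.isConnected.isPreconnected.subset_connectedComponent
      mem_irreducibleComponent
      (hne ⟨irreducibleComponent x, irreducibleComponent_mem_irreducibleComponents x⟩).some_mem)

/-- In a group with a Noetherian topology and continuous translations, the connected component of
the identity is a normal subgroup of finite index. -/
theorem exists_normal_eq_connectedComponent_one [TopologicalSpace G] [NoetherianSpace G]
    (hl : ∀ h : G, Continuous (h * ·)) (hr : ∀ h : G, Continuous (· * h)) :
    ∃ M : Subgroup G, M.Normal ∧ Finite (G ⧸ M) ∧ (M : Set G) = connectedComponent 1 := by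
  have key {φ : G → G} (hφ : Continuous φ) {x : G} (hx : x ∈ connectedComponent (1 : G))
      (h : φ x ∈ connectedComponent (1 : G)) {y : G} (hy : y ∈ connectedComponent (1 : G)) :
      φ y ∈ connectedComponent (1 : G) := by
    rw [connectedComponent_eq h]
    exact (isPreconnected_connectedComponent.image φ hφ.continuousOn).subset_connectedComponent
      ⟨x, hx, rfl⟩ ⟨y, hy, rfl⟩
  let M : Subgroup G :=
    { carrier := connectedComponent 1
      one_mem' := mem_connectedComponent
      mul_mem' := fun {x y} hx hy => key (hl x) mem_connectedComponent (by simpa using hx) hy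
      inv_mem' := fun {x} hx => by
        simpa using key (hl x⁻¹) hx (by simpa using mem_connectedComponent) mem_connectedComponent }
  refine ⟨M, ⟨fun x hx g => ?_⟩, ?_, rfl⟩
  · exact key ((hr g⁻¹).comp (hl g)) mem_connectedComponent
      (by simpa using mem_connectedComponent) hx
  · have := finite_connectedComponents_of_noetherianSpace G
    refine Finite.of_injective
      (fun q : G ⧸ M => (ConnectedComponents.mk q.out : ConnectedComponents G)) fun p q hpq => ?_
    rw [← p.out_eq', ← q.out_eq']
    refine QuotientGroup.eq.2 ?_
    have hpq : q.out ∈ connectedComponent p.out :=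
      ConnectedComponents.coe_eq_coe'.1 hpq.symm
    have := (isPreconnected_connectedComponent.image _
      (hl p.out⁻¹).continuousOn).subset_connectedComponent
      ⟨p.out, mem_connectedComponent, inv_mul_cancel _⟩ ⟨_, hpq, rfl⟩
    exact this

theorem IsPreconnected.eq_of_finite_image {X K : Type*} [TopologicalSpace X] {s : Set X}
    (hs : IsPreconnected s) {f : X → K} (hf : ∀ c, IsClosed {x | f x = c})
    (hfin : (f '' s).Finite) {x y : X} (hx : x ∈ s) (hy : y ∈ s) : f x = f y := by
  by_contra hne
  have hcl : IsClosed (⋃ c ∈ f '' s \ {f x}, {z | f z = c}) :=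
    hfin.sdiff.isClosed_biUnion fun c _ => hf c
  obtain ⟨z, -, hz, hz'⟩ := isPreconnected_closed_iff.1 hs _ _ (hf (f x)) hcl
    (fun z hz => by
      by_cases h : f z = f x
      · exact Or.inl h
      · exact Or.inr (Set.mem_biUnion ⟨⟨z, hz, rfl⟩, h⟩ rfl))
    ⟨x, hx, rfl⟩ ⟨y, hy, Set.mem_biUnion ⟨⟨y, hy, rfl⟩, Ne.symm hne⟩ rfl⟩
  obtain ⟨c, hc, rfl⟩ := Set.mem_iUnion₂.1 hz'
  exact hc.2 hz

end ConnectedComponent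

/-- A linear group has a normal subgroup `M` of finite index such that the characteristic
polynomial is constant on the commutator subgroup of `M` as soon as it takes finitely many values
there. -/
theorem exists_normal_charpoly_eq_on_commutator {G K : Type*} [Group G] [Field K] {n : ℕ}
    (b : G →* Matrix (Fin n) (Fin n) K) :
    ∃ M : Subgroup G, M.Normal ∧ Finite (G ⧸ M) ∧
      (((fun d : M => (b d).charpoly) '' commutator M).Finite →
        ∀ d ∈ commutator M, (b (d : M)).charpoly = (1 : Matrix (Fin n) (Fin n) K).charpoly) := by
  let := zariskiTopology b
  have := noetherianSpace_zariskiTopology b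
  have hl (h : G) : Continuous (h * ·) := continuous_zariskiTopology b fun f hf =>
    IsRegularMatrix.comp_mem
      (by simpa using (isRegularMatrix_const (b h)).mul isRegularMatrix_self)
      (by simpa using isRegularMatrix_inv.mul (isRegularMatrix_const (b h⁻¹))) hf
  have hr (h : G) : Continuous (· * h) := continuous_zariskiTopology b fun f hf =>
    IsRegularMatrix.comp_mem
      (by simpa using isRegularMatrix_self.mul (isRegularMatrix_const (b h)))
      (by simpa using (isRegularMatrix_const (b h⁻¹)).mul isRegularMatrix_inv) hf
  obtain ⟨M, hM, hfin, hMc⟩ := exists_normal_eq_connectedComponent_one hl hr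
  refine ⟨M, hM, hfin, fun hchar d hd => ?_⟩
  have hconn : IsPreconnected (M : Set G) := hMc ▸ isPreconnected_connectedComponent
  have step (c : M) (hc : c ∈ commutator M) (x y : M) :
      (b (c * ⁅x, y⁆ : M)).charpoly = (b c).charpoly := by
    ext k
    have hreg : IsRegularMatrix b (fun g => b (c * (g * y * g⁻¹ * (y : G)⁻¹))) := by
      simpa [mul_assoc] using (isRegularMatrix_const (b c)).mul
        (((isRegularMatrix_self.mul (isRegularMatrix_const (b y))).mul isRegularMatrix_inv).mul
          (isRegularMatrix_const (b (y : G)⁻¹)))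
    have := hconn.eq_of_finite_image
      (isClosed_zariskiTopology b (hreg.charpoly_coeff_mem k)) ?_ x.2 M.one_mem
    · simpa [commutatorElement_def] using this
    · refine (hchar.image (fun p => p.coeff k)).subset ?_
      rintro _ ⟨z, hz, rfl⟩
      refine ⟨_, ⟨c * ⁅(⟨z, hz⟩ : M), y⁆, mul_mem hc ?_, rfl⟩, ?_⟩
      · exact Subgroup.commutator_mem_commutator (Subgroup.mem_top _) (Subgroup.mem_top _)
      · simp [commutatorElement_def]
  rw [commutator_def, Subgroup.commutator_def] at hd
  induction hd using Subgroup.closure_induction_right with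
  | one => simp
  | mul_right c hc y hy ih =>
    obtain ⟨x, -, y, -, rfl⟩ := hy
    rw [step c hc, ih]
  | mul_inv_cancel c hc y hy ih =>
    obtain ⟨x, -, y, -, rfl⟩ := hy
    rw [commutatorElement_inv, step c hc, ih]

section Torsion

open Finset

theorem exists_perm_of_map_univ_eq {ι γ : Type*} [Fintype ι] [DecidableEq γ]
    {f g : ι → γ} (h : univ.val.map f = univ.val.map g) :
    ∃ σ : Equiv.Perm ι, ∀ j, f j = g (σ j) := by
  have e (c : γ) : Nonempty ({a // f a = c} ≃ {b // g b = c}) := by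
    have := congr_arg (Multiset.count c) h
    simp only [Multiset.count_map, eq_comm (a := c)] at this
    exact ⟨Fintype.equivOfCardEq <| by simpa only [Fintype.card_subtype] using! this⟩
  exact ⟨Equiv.ofFiberEquiv fun c => (e c).some, fun j => (Equiv.ofFiberEquiv_map _ j).symm⟩

theorem isOfFinOrder_of_forall_hom_rat {Λ : Type*} [CommGroup Λ] {x : Λ}
    (h : ∀ v : Additive Λ →+ ℚ, v (.ofMul x) = 0) : IsOfFinOrder x := by
  by_contra hx
  have hinj : Function.Injective (zmultiplesHom (Additive Λ) (.ofMul x)) :=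
    injective_zsmul_iff_not_isOfFinAddOrder.2 (isOfFinAddOrder_ofMul_iff.not.2 hx)
  obtain ⟨v, hv⟩ := (Module.Baer.of_divisible ℚ).extension_property_addMonoidHom _ hinj
    (Int.castAddHom ℚ)
  have := DFunLike.congr_fun hv 1
  simp [h] at this

theorem isOfFinOrder_of_mul_eq_perm {Λ ι : Type*} [CommGroup Λ] [Fintype ι] [DecidableEq ι]
    {α β : ι → Λ} (σ : Equiv.Perm ι) (hσ : ∀ j, α j * β j = α (σ j)) (κ : ι → ι)
    (hκ : ∀ j, α (κ j) = α j) (hβ : ∀ c, ∏ k with κ k = c, β k = 1) (j : ι) :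
    IsOfFinOrder (β j) := by
  refine isOfFinOrder_of_forall_hom_rat fun v => ?_
  set x : ι → ℚ := fun j => v (.ofMul (α j))
  set y : ι → ℚ := fun j => v (.ofMul (β j))
  have hxy (j) : x j + y j = x (σ j) := by
    simp only [x, y, ← hσ, ofMul_mul, map_add]
  have hy (c) : ∑ k with κ k = c, y k = 0 := by
    simp only [y, ← map_sum, ← ofMul_prod, hβ, ofMul_one, map_zero]
  have hcross : ∑ j, x j * y j = 0 := by
    rw [← sum_fiberwise _ κ]
    refine sum_eq_zero fun c _ => ?_
    rw [← mul_zero (x c), ← hy c, mul_sum]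
    refine sum_congr rfl fun k hk => ?_
    rw [← (mem_filter.1 hk).2]
    simp only [x, hκ]
  have hsq : ∑ j, x j ^ 2 + ∑ j, y j ^ 2 = ∑ j, x j ^ 2 :=
    calc ∑ j, x j ^ 2 + ∑ j, y j ^ 2 = ∑ j, x (σ j) ^ 2 := by
          simp only [← hxy, add_sq, sum_add_distrib, mul_assoc, ← mul_sum, hcross, mul_zero,
            add_zero]
      _ = _ := Equiv.sum_comp σ (fun j => x j ^ 2)
  have := (sum_eq_zero_iff_of_nonneg fun j _ => sq_nonneg (y j)).1 (add_eq_left.1 hsq) j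
    (mem_univ j)
  exact pow_eq_zero_iff two_ne_zero |>.1 this

/-- Bounded torsion: the exponent `N` depends only on the size of the index type and on `Λ`. -/
theorem exists_pow_eq_one_of_map_mul_eq (Λ ι : Type*) [CommGroup Λ] [DecidableEq Λ]
    [Fintype ι] [DecidableEq ι] :
    ∃ N : ℕ, 0 < N ∧ ∀ α β : ι → Λ,
      univ.val.map (fun j => α j * β j) = univ.val.map α →
      (∀ c, ∏ k with α k = c, β k = 1) → ∀ j, β j ^ N = 1 := by
  have key (t : Equiv.Perm ι × (ι → ι) × ι) : ∃ N : ℕ, 0 < N ∧ ∀ α β : ι → Λ,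
      (∀ j, α j * β j = α (t.1 j)) → (∀ j, α (t.2.1 j) = α j) →
      (∀ c, ∏ k with t.2.1 k = c, β k = 1) → β t.2.2 ^ N = 1 := by
    obtain ⟨σ, κ, j⟩ := t
    let S := {p : (ι → Λ) × (ι → Λ) // (∀ j, p.1 j * p.2 j = p.1 (σ j)) ∧
      (∀ j, p.1 (κ j) = p.1 j) ∧ ∀ c, ∏ k with κ k = c, p.2 k = 1}
    obtain ⟨N, hN, h⟩ := isOfFinOrder_iff_pow_eq_one.1 <|
      isOfFinOrder_of_mul_eq_perm (α := fun j (s : S) => s.1.1 j) (β := fun j (s : S) => s.1.2 j)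
        σ (fun j => funext fun s => s.2.1 j) κ (fun j => funext fun s => s.2.2.1 j)
        (fun c => funext fun s => by simpa using s.2.2.2 c) j
    exact ⟨N, hN, fun α β h₁ h₂ h₃ => congr_fun h ⟨(α, β), h₁, h₂, h₃⟩⟩
  choose N hN h using key
  refine ⟨∏ t, N t, prod_pos fun t _ => hN t, fun α β hαβ hβ j => ?_⟩
  obtain ⟨σ, hσ⟩ := exists_perm_of_map_univ_eq hαβ
  have : Nonempty ι := ⟨j⟩
  have hκ (k) : α (Function.invFun α (α k)) = α k := Function.invFun_eq ⟨k, rfl⟩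
  have ht := h (σ, fun k => Function.invFun α (α k), j) α β hσ hκ
    fun c => by
      obtain hc | ⟨k₀, rfl⟩ := em' (∃ k₀, Function.invFun α (α k₀) = c)
      · exact prod_eq_one fun k hk => (hc ⟨k, (mem_filter.1 hk).2⟩).elim
      · rw [← hβ (α k₀)]
        refine prod_congr (filter_congr fun k _ => ⟨fun e => ?_, congr_arg (Function.invFun α)⟩)
          fun _ _ => rfl
        rw [← hκ k, ← hκ k₀]
        exact congr_arg α e
  obtain ⟨m, hm⟩ := dvd_prod_of_mem N (mem_univ (σ, fun k => Function.invFun α (α k), j))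
  rw [hm, pow_mul, ht, one_pow]

end Torsion

section Unipotent

open Module

theorem LinearMap.eq_zero_of_forall_trace_mul_eq_zero {K V : Type*} [Field K] [AddCommGroup V]
    [Module K V] [FiniteDimensional K V] {N : End K V}
    (h : ∀ f : End K V, LinearMap.trace K V (f * N) = 0) : N = 0 := by
  ext x
  rw [LinearMap.zero_apply, ← forall_dual_apply_eq_zero_iff K]
  intro φ
  have : (φ.smulRight x) * N = (φ ∘ₗ N).smulRight x := rfl
  simpa [this, LinearMap.trace_smulRight] using h (φ.smulRight x)

theorem LinearMap.trace_eq_finrank_of_isNilpotent_sub_one {K V : Type*} [Field K]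
    [AddCommGroup V] [Module K V] [FiniteDimensional K V] {f : End K V}
    (h : IsNilpotent (f - 1)) : LinearMap.trace K V f = finrank K V := by
  have := (LinearMap.isNilpotent_trace_of_isNilpotent h).eq_zero
  rwa [map_sub, LinearMap.trace_one, sub_eq_zero] at this

variable {D K A : Type*} [Group D] [Field K] [IsAlgClosed K] [Ring A] [Algebra K A]

theorem sub_one_smul_eq_zero_of_isNilpotent (ρ : D →* A)
    (hspan : Submodule.span K (Set.range ρ) = ⊤)
    (hρ : ∀ d, IsNilpotent (ρ d - 1)) {S : Type*} [AddCommGroup S] [Module K S] [Module A S]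
    [IsScalarTower K A S] [FiniteDimensional K S] [IsSimpleModule A S] (d : D) (s : S) :
    (ρ d - 1) • s = 0 := by
  let L : A →ₐ[K] End K S := Algebra.lsmul K K S
  have hunip (c : D) : IsNilpotent (L (ρ c) - 1) := by
    simpa using (hρ c).map L
  have htr (r : A) : LinearMap.trace K S (L r * L (ρ d - 1)) = 0 := by
    have hr : r ∈ Submodule.span K (Set.range ρ) := hspan ▸ Submodule.mem_top
    induction hr using Submodule.span_induction with
    | mem _ h =>
      obtain ⟨c, rfl⟩ := h
      rw [map_sub, mul_sub, ← map_mul, ← map_mul, map_one, mul_one, map_sub,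
        LinearMap.trace_eq_finrank_of_isNilpotent_sub_one (hunip _),
        LinearMap.trace_eq_finrank_of_isNilpotent_sub_one (hunip _), sub_self]
    | zero => simp
    | add x y _ _ hx hy => rw [map_add, add_mul, map_add, hx, hy, add_zero]
    | smul c x _ hx => rw [map_smul, smul_mul_assoc, map_smul, hx, smul_zero]
  have hL : L (ρ d - 1) = 0 := by
    refine LinearMap.eq_zero_of_forall_trace_mul_eq_zero fun f => ?_
    have hschur := (IsSimpleModule.algebraMap_end_bijective_of_isAlgClosed (A := A) (V := S) K).2
    let F : End (End A S) S :=
      { toFun := f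
        map_add' := f.map_add
        map_smul' := fun e x => by
          obtain ⟨c, rfl⟩ := hschur e
          simp }
    obtain ⟨t, ht⟩ := (inferInstance : FiniteDimensional K S).fg_top
    obtain ⟨r, hr⟩ := jacobson_density F t
    have : f = L r := by
      refine LinearMap.ext_on ht fun x hx => hr x hx
    rw [this, htr]
  exact LinearMap.congr_fun hL s

/-- **Kolchin's theorem**: if a group of unipotent elements spans a finite-dimensional algebra, then
it acts trivially on every simple module, hence is trivial modulo the Jacobson radical. -/
theorem sub_one_mem_jacobson [FiniteDimensional K A] (ρ : D →* A)
    (hspan : Submodule.span K (Set.range ρ) = ⊤)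
    (hρ : ∀ d, IsNilpotent (ρ d - 1)) (d : D) : ρ d - 1 ∈ Ring.jacobson A := by
  refine (Submodule.mem_sInf).2 fun m hm => ?_
  have : IsSimpleModule A (A ⧸ m) := isSimpleModule_iff_isCoatom.2 hm
  have : FiniteDimensional K (A ⧸ m) :=
    Module.Finite.of_surjective (m.mkQ.restrictScalars K) m.mkQ_surjective
  have := sub_one_smul_eq_zero_of_isNilpotent ρ hspan hρ (S := A ⧸ m) d (m.mkQ 1)
  rwa [← map_smul, smul_eq_mul, mul_one, Submodule.mkQ_apply, Submodule.Quotient.mk_eq_zero] at this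

/-- A group of units congruent to `1` modulo a nilpotent ideal is nilpotent. -/
theorem isNilpotent_of_sub_one_mem {R : Type*} [Ring R] (J : Ideal R) [J.IsTwoSided]
    (hJ : IsNilpotent J) (ρ : D →* R) (hinj : Function.Injective ρ)
    (h : ∀ d, ρ d - 1 ∈ J) : Group.IsNilpotent D := by
  obtain ⟨k, hk⟩ := hJ
  let H (i : ℕ) : Subgroup D :=
    { carrier := {d | ρ d - 1 ∈ J ^ (i + 1)}
      one_mem' := by simp
      mul_mem' := fun {x y} hx hy => by
        have : ρ (x * y) - 1 = ρ x * (ρ y - 1) + (ρ x - 1) := by rw [map_mul]; noncomm_ring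
        rw [Set.mem_ofPred_eq, this]
        exact add_mem (Ideal.mul_mem_left _ _ hy) hx
      inv_mem' := fun {x} hx => by
        have : ρ x⁻¹ - 1 = -(ρ x⁻¹ * (ρ x - 1)) := by
          rw [mul_sub, ← map_mul, inv_mul_cancel, map_one, mul_one, neg_sub]
        rw [Set.mem_ofPred_eq, this]
        exact neg_mem (Ideal.mul_mem_left _ _ hx) }
  refine (Subgroup.nilpotent_iff_finite_descending_central_series D).2 ⟨k, H, ⟨?_, ?_⟩, ?_⟩
  · exact eq_top_iff.2 fun d _ => by
      change ρ d - 1 ∈ J ^ 1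
      rw [Submodule.pow_one]
      exact h d
  · intro x i hx g
    have : ρ ⁅x, g⁆ - 1 =
        ((ρ x - 1) * (ρ g - 1) - (ρ g - 1) * (ρ x - 1)) * ρ (x⁻¹ * g⁻¹) := by
      have : (1 : R) = ρ (g * x) * ρ (x⁻¹ * g⁻¹) := by
        rw [← map_mul]; simp [mul_assoc]
      rw [commutatorElement_def, mul_assoc, map_mul]
      nth_rw 1 [this]
      rw [← sub_mul, map_mul, map_mul]
      congr 1
      noncomm_ring
    change _ ∈ J ^ (i + 1 + 1)
    rw [this]
    refine Ideal.mul_mem_right _ _ (sub_mem ?_ ?_)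
    · rw [Submodule.pow_succ]
      exact Ideal.mul_mem_mul hx (h g)
    · rw [Ideal.IsTwoSided.pow_succ]
      exact Ideal.mul_mem_mul (h g) hx
  · refine eq_bot_iff.2 fun d hd => ?_
    have : ρ d - 1 ∈ J ^ (k + 1) := hd
    rw [Submodule.pow_succ, hk, zero_mul] at this
    exact hinj ((sub_eq_zero.1 this).trans (map_one ρ).symm)

/-- A group of unipotent matrices is nilpotent. -/
theorem isNilpotent_of_forall_isNilpotent_sub_one (K : Type*) {D A : Type*} [Group D] [Field K]
    [IsAlgClosed K] [Ring A] [Algebra K A] [FiniteDimensional K A] (ρ : D →* A)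
    (hinj : Function.Injective ρ) (hρ : ∀ d, IsNilpotent (ρ d - 1)) : Group.IsNilpotent D := by
  let B := Algebra.adjoin K (Set.range ρ)
  let ρ' : D →* B := ρ.codRestrict B fun d => Algebra.subset_adjoin ⟨d, rfl⟩
  have hspan : Submodule.span K (Set.range ρ') = ⊤ := by
    refine Submodule.map_injective_of_injective (f := B.val.toLinearMap)
      Subtype.val_injective ?_
    rw [Submodule.map_span, ← Set.range_comp, Submodule.map_top]
    have h1 : (B.val.toLinearMap : B → A) ∘ ρ' = ρ := rfl
    have h2 : LinearMap.range B.val.toLinearMap = Subalgebra.toSubmodule B := by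
      ext x; simp
    rw [h1, h2, Algebra.adjoin_eq_span, ← MonoidHom.coe_mrange, Submonoid.closure_eq]
  have hρ' (d : D) : IsNilpotent (ρ' d - 1) :=
    (IsNilpotent.map_iff (f := B.val) Subtype.val_injective).1
      (by rw [map_sub, map_one]; exact hρ d)
  have : IsArtinianRing B := IsArtinianRing.of_finite K B
  exact isNilpotent_of_sub_one_mem (Ring.jacobson B) IsSemiprimaryRing.isNilpotent ρ'
    (fun x y hxy => hinj (congr_arg Subtype.val hxy)) (sub_one_mem_jacobson ρ' hspan hρ')

end Unipotent

section Eigenvalues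

open Module Polynomial

theorem Matrix.det_blockDiagonal' {R o : Type*} [CommRing R] [Fintype o] [DecidableEq o]
    {m : o → Type*} [∀ i, Fintype (m i)] [∀ i, DecidableEq (m i)]
    (M : ∀ i, Matrix (m i) (m i) R) :
    (Matrix.blockDiagonal' M).det = ∏ i, (M i).det := by
  let _ : LinearOrder o := LinearOrder.lift' (Fintype.equivFin o) (Fintype.equivFin o).injective
  have h : (Matrix.blockDiagonal' M).BlockTriangular Sigma.fst := fun i j hij =>
    Matrix.blockDiagonal'_apply_ne M _ _ (ne_of_gt hij)
  have := h.det_fintype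
  convert this using 2 with k
  rw [← Matrix.det_submatrix_equiv_self (Equiv.sigmaSubtype k).symm]
  congr 1
  ext x y
  simp [Matrix.toSquareBlock_def, Equiv.sigmaSubtype, Matrix.blockDiagonal'_apply]

theorem Matrix.charpoly_blockDiagonal' {R o : Type*} [CommRing R] [Fintype o] [DecidableEq o]
    {m : o → Type*} [∀ i, Fintype (m i)] [∀ i, DecidableEq (m i)]
    (M : ∀ i, Matrix (m i) (m i) R) :
    (Matrix.blockDiagonal' M).charpoly = ∏ i, (M i).charpoly := by
  have : (Matrix.blockDiagonal' M).charmatrix =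
      Matrix.blockDiagonal' fun i => (M i).charmatrix := by
    ext ⟨i, x⟩ ⟨j, y⟩
    rcases eq_or_ne i j with rfl | hij
    · simp [Matrix.charmatrix_apply, Matrix.diagonal_apply]
    · simp [Matrix.blockDiagonal'_apply, hij]
  rw [Matrix.charpoly, this, Matrix.det_blockDiagonal']
  rfl

variable {K V : Type*} [Field K] [AddCommGroup V] [Module K V] [FiniteDimensional K V]

theorem LinearMap.charpoly_eq_prod_charpoly_restrict {ι : Type*} [DecidableEq ι] [Fintype ι]
    {N : ι → Submodule K V} (h : DirectSum.IsInternal N) {f : End K V}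
    (hf : ∀ i, Set.MapsTo f (N i) (N i)) :
    f.charpoly = ∏ i, (f.restrict (hf i)).charpoly := by
  let b : (i : ι) → Basis _ K (N i) := fun i ↦ Module.Free.chooseBasis K (N i)
  rw [← LinearMap.charpoly_toMatrix f (h.collectedBasis b),
    LinearMap.toMatrix_directSum_collectedBasis_eq_blockDiagonal' h h b b hf,
    Matrix.charpoly_blockDiagonal']
  simp_rw [LinearMap.charpoly_toMatrix]

theorem LinearMap.charpoly_eq_prod_charpoly_restrict_maxGenEigenspace [IsAlgClosed K]
    (f : End K V) : ∃ s : Finset K, (∀ c ∉ s, f.maxGenEigenspace c = ⊥) ∧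
      ∀ g : End K V, ∀ h : Commute f g,
      g.charpoly = ∏ c ∈ s,
        (g.restrict (End.mapsTo_maxGenEigenspace_of_comm h c)).charpoly := by
  classical
  have hds : DirectSum.IsInternal f.maxGenEigenspace :=
    (DirectSum.isInternal_submodule_iff_iSupIndep_and_iSup_eq_top _).2
      ⟨f.independent_maxGenEigenspace, End.iSup_maxGenEigenspace_eq_top f⟩
  have hN : {c | f.maxGenEigenspace c ≠ ⊥}.Finite :=
    WellFoundedGT.finite_ne_bot_of_iSupIndep f.independent_maxGenEigenspace
  refine ⟨hN.toFinset, by simp, fun g h => ?_⟩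
  let _ : Fintype {c // f.maxGenEigenspace c ≠ ⊥} := hN.fintype
  let _ : Fintype {c // c ∈ {c | f.maxGenEigenspace c ≠ ⊥}} := hN.fintype
  rw [← Finset.prod_coe_sort, LinearMap.charpoly_eq_prod_charpoly_restrict
    (DirectSum.isInternal_ne_bot_iff.mpr hds)
    (fun c => End.mapsTo_maxGenEigenspace_of_comm h c)]
  exact Fintype.prod_equiv hN.subtypeEquivToFinset _ _ fun c => rfl

theorem LinearMap.charpoly_of_isNilpotent_sub_smul {f : End K V} {c : K}
    (h : IsNilpotent (f - c • (1 : End K V))) : f.charpoly = (X - C c) ^ finrank K V := by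
  have h1 := h.charpoly_eq_X_pow_finrank
  rw [LinearMap.charpoly_sub_smul] at h1
  have h2 := congrArg (fun p => p.comp (X - C c)) h1
  simpa [Polynomial.comp_assoc] using h2

theorem Module.End.isNilpotent_restrict_maxGenEigenspace_sub_smul (f : End K V) (c : K)
    (h : Set.MapsTo f (f.maxGenEigenspace c) (f.maxGenEigenspace c)) :
    IsNilpotent (f.restrict h - c • (1 : End K (f.maxGenEigenspace c))) := by
  exact f.isNilpotent_restrict_maxGenEigenspace_sub_algebraMap c

theorem LinearMap.charpoly_eq_prod_roots [IsAlgClosed K] (f : End K V) :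
    f.charpoly = (f.charpoly.roots.map fun d => X - C d).prod :=
  (IsAlgClosed.splits _).eq_prod_roots_of_monic f.charpoly_monic

theorem LinearMap.charpoly_mul_of_isNilpotent_sub_smul [IsAlgClosed K] {f g : End K V} {c : K}
    (hf : IsNilpotent (f - c • (1 : End K V))) (hfg : Commute f g) :
    (f * g).charpoly = (g.charpoly.roots.map fun d => X - C (c * d)).prod := by
  obtain ⟨s, -, hs⟩ := LinearMap.charpoly_eq_prod_charpoly_restrict_maxGenEigenspace g
  rw [hs g rfl, hs (f * g) ((hfg.symm).mul_right rfl), roots_prod _ _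
    (Finset.prod_ne_zero_iff.2 fun c _ => (LinearMap.charpoly_monic _).ne_zero),
    Multiset.map_bind, Multiset.prod_bind]
  refine Finset.prod_congr rfl fun d _ => ?_
  have hg := g.isNilpotent_restrict_maxGenEigenspace_sub_smul d
    (End.mapsTo_maxGenEigenspace_of_comm rfl d)
  rw [LinearMap.charpoly_of_isNilpotent_sub_smul hg, LinearMap.charpoly_of_isNilpotent_sub_smul
    (c := c * d)]
  · simp [Multiset.nsmul_singleton]
  set W := g.maxGenEigenspace d
  have hfW := End.mapsTo_maxGenEigenspace_of_comm hfg.symm d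
  have hgW : Set.MapsTo g W W := End.mapsTo_maxGenEigenspace_of_comm rfl d
  have hf' : IsNilpotent (f.restrict hfW - c • (1 : End K W)) := by
    exact Module.End.isNilpotent.restrict (p := W) (f := f - c • 1)
      (fun x hx => W.sub_mem (hfW hx) (W.smul_mem c hx)) hf
  have hcomm : Commute (f.restrict hfW) (g.restrict hgW) := LinearMap.restrict_commute hfg _ _
  have : (f * g).restrict (End.mapsTo_maxGenEigenspace_of_comm ((hfg.symm).mul_right rfl) d)
      - (c * d) • (1 : End K W) = (f.restrict hfW - c • (1 : End K W)) * g.restrict hgW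
      + c • (g.restrict hgW - d • (1 : End K W)) := by
    rw [sub_mul, smul_sub, smul_smul, smul_one_mul, sub_add_sub_cancel]
    rfl
  rw [this]
  have hc1 : Commute (f.restrict hfW - c • (1 : End K W)) (g.restrict hgW) :=
    hcomm.sub_left ((Commute.one_left _).smul_left c)
  refine Commute.isNilpotent_add ?_ (hc1.isNilpotent_mul_right hf') (hg.smul c)
  refine Commute.smul_right (Commute.sub_right ?_ ((Commute.one_right _).smul_right d)) c
  exact hc1.mul_left rfl

theorem LinearMap.exists_multiset_of_commute [IsAlgClosed K] [DecidableEq K] {f g : End K V}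
    (h : Commute f g) : ∃ S : Multiset (K × K), S.map Prod.fst = f.charpoly.roots ∧
      S.map Prod.snd = g.charpoly.roots ∧
      S.map (fun p => p.1 * p.2) = (f * g).charpoly.roots ∧
      ∀ c, ((S.filter fun p => p.1 = c).map Prod.snd).prod =
        LinearMap.det (g.restrict (End.mapsTo_maxGenEigenspace_of_comm h c)) := by
  obtain ⟨s, hbot, hs⟩ := LinearMap.charpoly_eq_prod_charpoly_restrict_maxGenEigenspace f
  let T (c : K) := (g.restrict (End.mapsTo_maxGenEigenspace_of_comm h c)).charpoly.roots
  have hf (c : K) := f.isNilpotent_restrict_maxGenEigenspace_sub_smul c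
    (End.mapsTo_maxGenEigenspace_of_comm rfl c)
  have hne (t : End K V) (ht : Commute f t) : ∏ c ∈ s,
      (t.restrict (End.mapsTo_maxGenEigenspace_of_comm ht c)).charpoly ≠ 0 :=
    Finset.prod_ne_zero_iff.2 fun c _ => (LinearMap.charpoly_monic _).ne_zero
  refine ⟨s.val.bind fun c => (T c).map (Prod.mk c), ?_, ?_, ?_, fun c => ?_⟩
  · rw [hs f rfl, roots_prod _ _ (hne f rfl), Multiset.map_bind]
    refine Multiset.bind_congr fun c _ => ?_
    have hcard : Multiset.card (T c) = finrank K (f.maxGenEigenspace c) := by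
      rw [← LinearMap.charpoly_natDegree (g.restrict (End.mapsTo_maxGenEigenspace_of_comm h c))]
      exact (IsAlgClosed.splits _).natDegree_eq_card_roots.symm
    rw [LinearMap.charpoly_of_isNilpotent_sub_smul (hf c)]
    simp [Multiset.nsmul_singleton, hcard]
  · rw [hs g h, roots_prod _ _ (hne g h), Multiset.map_bind]
    refine Multiset.bind_congr fun c _ => ?_
    simp [T]
  · rw [hs (f * g) (Commute.mul_right rfl h), roots_prod _ _ (hne _ (Commute.mul_right rfl h)),
      Multiset.map_bind]
    refine Multiset.bind_congr fun c _ => ?_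
    have := LinearMap.charpoly_mul_of_isNilpotent_sub_smul (hf c)
      (LinearMap.restrict_commute h _ (End.mapsTo_maxGenEigenspace_of_comm h c))
    have h2 : (f * g).restrict (End.mapsTo_maxGenEigenspace_of_comm (Commute.mul_right rfl h) c) =
      f.restrict (End.mapsTo_maxGenEigenspace_of_comm rfl c) *
        g.restrict (End.mapsTo_maxGenEigenspace_of_comm h c) := rfl
    rw [h2, this]
    have h3 := roots_multiset_prod_X_sub_C ((T c).map fun d => c * d)
    rw [Multiset.map_map] at h3
    rw [Multiset.map_map]
    exact h3.symm
  · have hdet : LinearMap.det (g.restrict (End.mapsTo_maxGenEigenspace_of_comm h c)) =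
        (T c).prod := Module.End.det_eq_prod_roots_charpoly_of_splits (IsAlgClosed.splits _)
    rw [hdet, Multiset.filter_bind, Multiset.map_bind, Multiset.prod_bind]
    have h1 (d : K) : (((T d).map (Prod.mk d)).filter fun p => p.1 = c).map Prod.snd =
        if d = c then T d else 0 := by
      rw [Multiset.filter_map]
      split_ifs with hd <;> simp [hd]
    simp_rw [h1]
    change ∏ d ∈ s, _ = _
    rw [Finset.prod_eq_single c]
    · simp
    · intro d _ hd
      simp [hd]
    · intro hc
      have : Subsingleton (f.maxGenEigenspace c) := by rw [hbot c hc]; infer_instance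
      rw [if_pos rfl, ← hdet]
      exact LinearMap.det_eq_one_of_subsingleton _

/-- A finite multiset of pairs is listed by a pair of functions. -/
theorem Multiset.exists_map_univ_eq {γ : Type*} (S : Multiset γ) {n : ℕ}
    (h : Multiset.card S = n) : ∃ p : Fin n → γ, (Finset.univ : Finset (Fin n)).val.map p = S := by
  induction S using Quotient.inductionOn with
  | h l =>
    obtain rfl : l.length = n := h
    exact ⟨l.get, by simp⟩

theorem exists_units_of_commute [IsAlgClosed K] [DecidableEq K] {G : Type*} [Group G]
    (a b : G →* End K V) (hab : ∀ g h, Commute (a g) (b h))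
    (hchar : ∀ g, (a g * b g).charpoly = (a g).charpoly) {g : G} (hg : g ∈ commutator G) :
    ∃ α β : Fin (finrank K V) → Kˣ,
      Finset.univ.val.map (fun j => α j * β j) = Finset.univ.val.map α ∧
      (∀ c, ∏ k with α k = c, β k = 1) ∧
      (b g).charpoly = ∏ j, (X - C (β j : K)) := by
  obtain ⟨S, h1, h2, h3, h4⟩ := LinearMap.exists_multiset_of_commute (hab g g)
  have hcard : Multiset.card S = finrank K V := by
    rw [← Multiset.card_map Prod.fst, h1, ← (a g).charpoly_natDegree]
    exact (IsAlgClosed.splits _).natDegree_eq_card_roots.symm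
  obtain ⟨p, rfl⟩ := S.exists_map_univ_eq hcard
  have hdet (c : G →* End K V) (x : K) (hx : x ∈ (c g).charpoly.roots) : x ≠ 0 := by
    rintro rfl
    have : IsUnit (LinearMap.det (c g)) := ((Group.isUnit g).map c).map LinearMap.det
    refine this.ne_zero ?_
    rw [Module.End.det_eq_prod_roots_charpoly_of_splits (IsAlgClosed.splits _)]
    exact Multiset.prod_eq_zero hx
  have hα (j) : (p j).1 ≠ 0 := hdet a _ (h1 ▸ by simp)
  have hβ (j) : (p j).2 ≠ 0 := hdet b _ (h2 ▸ by simp)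
  refine ⟨fun j => Units.mk0 _ (hα j), fun j => Units.mk0 _ (hβ j), ?_, fun c => ?_, ?_⟩
  · refine Multiset.map_injective Units.val_injective ?_
    rw [hchar, ← h1] at h3
    simpa [Function.comp_def] using h3
  · have hdet1 : LinearMap.det ((b g).restrict
        (End.mapsTo_maxGenEigenspace_of_comm (hab g g) c)) = 1 := by
      let D : G →* K :=
        { toFun := fun h => LinearMap.det ((b h).restrict
            (End.mapsTo_maxGenEigenspace_of_comm (hab g h) c))
          map_one' := by
            refine Eq.trans (congrArg LinearMap.det ?_) LinearMap.det.map_one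
            ext; simp
          map_mul' := fun x y => by
            refine Eq.trans (congrArg LinearMap.det ?_) (LinearMap.det.map_mul _ _)
            ext v
            exact LinearMap.congr_fun (b.map_mul x y) (v : V) }
      have : commutator G ≤ D.toHomUnits.ker := Abelianization.commutator_subset_ker _
      exact congrArg Units.val (MonoidHom.mem_ker.1 (this hg))
    specialize h4 c
    rw [hdet1] at h4
    refine Units.ext ?_
    rw [Units.val_one, ← h4, Units.coe_prod, Multiset.filter_map, Multiset.map_map]
    simp_rw [Units.ext_iff]
    rfl
  · rw [(b g).charpoly_eq_prod_roots, ← h2, Multiset.map_map, Multiset.map_map]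
    rfl

end Eigenvalues

section Automorphisms

open Monoid Module Polynomial

/-- If two commuting representations `a` and `b` of `G` are such that `a g * b g` and `a g` always
have the same characteristic polynomial, and `b` is faithful, then `G` is
nilpotent-by-abelian-by-finite. -/
theorem isNilpotentByAbelianByFinite_of_commute {G K : Type*} [Group G] [Field K]
    [IsAlgClosed K] {n : ℕ} (a b : G →* Matrix (Fin n) (Fin n) K)
    (hb : Function.Injective b) (hab : ∀ g h, Commute (a g) (b h))
    (hchar : ∀ g, (a g * b g).charpoly = (a g).charpoly) : IsNilpotentByAbelianByFinite G := by
  classical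
  obtain ⟨M, hM, hfin, hconst⟩ := exists_normal_charpoly_eq_on_commutator b
  obtain ⟨N, hN, htors⟩ := exists_pow_eq_one_of_map_mul_eq Kˣ (Fin (finrank K (Fin n → K)))
  have : NeZero N := ⟨hN.ne'⟩
  let L : Matrix (Fin n) (Fin n) K ≃ₐ[K] End K (Fin n → K) := Matrix.toLinAlgEquiv'
  have hL (A : Matrix (Fin n) (Fin n) K) : (L A).charpoly = A.charpoly := Matrix.charpoly_toLin' A
  let toEnd (c : G →* Matrix (Fin n) (Fin n) K) : M →* End K (Fin n → K) :=
    (L : Matrix (Fin n) (Fin n) K →* End K (Fin n → K)).comp (c.comp M.subtype)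
  have hfinite : ((fun d : M => (b d).charpoly) '' commutator M).Finite := by
    refine (Set.finite_range fun β : Fin (finrank K (Fin n → K)) → rootsOfUnity N K =>
      ∏ j, (X - C ((β j : Kˣ) : K))).subset ?_
    rintro _ ⟨d, hd, rfl⟩
    obtain ⟨α, β, h1, h2, h3⟩ := exists_units_of_commute (toEnd a) (toEnd b)
      (fun g h => (hab g h).map L)
      (fun g => by
        change (L (a g) * L (b g)).charpoly = (L (a g)).charpoly
        rw [← map_mul, hL, hL, hchar]) hd
    exact ⟨fun j => ⟨β j, (mem_rootsOfUnity N _).2 (htors α β h1 h2 j)⟩,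
      h3.symm.trans (hL _)⟩
  refine ⟨M, hM, hfin, commutator M, inferInstance, ?_, le_rfl⟩
  refine isNilpotent_of_forall_isNilpotent_sub_one K
    (b.comp (M.subtype.comp (commutator M).subtype))
    (hb.comp (Subtype.val_injective.comp Subtype.val_injective)) fun d => ?_
  have hd := hconst hfinite d d.2
  have hone : (1 : Matrix (Fin n) (Fin n) K).charpoly = (X - 1) ^ n := by
    simpa using Matrix.charpoly_one (R := K) (n := Fin n)
  refine ⟨n, ?_⟩
  have := Matrix.aeval_self_charpoly (b (d : M))
  rw [hd, hone] at this
  simpa using this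

variable {G : Type*} [Group G]

theorem FreeProdZ.eq_one_of_commute {g : G}
    (h : Commute (Coprod.inl g : FreeProdZ G) (Coprod.inr (FreeGroup.of ()))) : g = 1 := by
  classical
  let ρ : G →* Equiv.Perm (Option G) :=
    { toFun := fun g => Equiv.optionCongr (Equiv.mulLeft g)
      map_one' := by ext x; cases x <;> simp
      map_mul' := fun x y => by ext z; cases z <;> simp [mul_assoc] }
  let σ : FreeGroup Unit →* Equiv.Perm (Option G) :=
    FreeGroup.lift fun _ => Equiv.swap none (some 1)
  have := congrArg (fun e : Equiv.Perm (Option G) => e none) (h.map (Coprod.lift ρ σ)).eq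
  simpa [ρ, σ] using this

/-- The automorphism of `G * ℤ` fixing `G` and mapping the generator `x` of `ℤ` to `g * x`. -/
def FreeProdZ.transvectionHom (g : G) : FreeProdZ G →* FreeProdZ G :=
  Coprod.lift Coprod.inl
    (FreeGroup.lift fun _ => Coprod.inl g * Coprod.inr (FreeGroup.of ()))

theorem FreeProdZ.hom_ext {P : Type*} [Monoid P] {f f' : FreeProdZ G →* P}
    (h : ∀ g, f (Coprod.inl g) = f' (Coprod.inl g))
    (hx : f (Coprod.inr (FreeGroup.of ())) = f' (Coprod.inr (FreeGroup.of ()))) : f = f' :=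
  Coprod.hom_ext (MonoidHom.ext h) (FreeGroup.ext_hom _ _ fun _ => hx)

@[simp]
theorem FreeProdZ.transvectionHom_inl (g h : G) :
    transvectionHom g (Coprod.inl h) = Coprod.inl h := by
  simp [transvectionHom]

@[simp]
theorem FreeProdZ.transvectionHom_inr (g : G) :
    transvectionHom g (Coprod.inr (FreeGroup.of ())) =
      Coprod.inl g * Coprod.inr (FreeGroup.of ()) := by
  simp [transvectionHom]

theorem FreeProdZ.transvectionHom_comp (g h : G) :
    (transvectionHom g).comp (transvectionHom h) = transvectionHom (h * g) :=
  FreeProdZ.hom_ext (by simp) (by simp [mul_assoc])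

theorem FreeProdZ.transvectionHom_one :
    transvectionHom (1 : G) = MonoidHom.id _ :=
  FreeProdZ.hom_ext (by simp) (by simp)

/-- The transvections `x ↦ g⁻¹ * x` form a copy of `G` in the automorphism group of `G * ℤ`. -/
def FreeProdZ.transvection : G →* MulAut (FreeProdZ G) where
  toFun g := MonoidHom.toMulEquiv (transvectionHom g⁻¹) (transvectionHom g)
    (by rw [transvectionHom_comp, inv_mul_cancel, transvectionHom_one])
    (by rw [transvectionHom_comp, mul_inv_cancel, transvectionHom_one])
  map_one' := MulEquiv.ext fun x => by simp [transvectionHom_one]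
  map_mul' g h := MulEquiv.ext fun x => by
    simpa using (DFunLike.congr_fun (transvectionHom_comp g⁻¹ h⁻¹) x).symm

theorem FreeProdZ.transvection_apply (g : G) (x : FreeProdZ G) :
    transvection g x = transvectionHom g⁻¹ x := rfl

theorem FreeProdZ.commute_transvection_conj (g h : G) :
    Commute (transvection g) (MulAut.conj (Coprod.inl h)) :=
  MulEquiv.ext fun x => by simp [transvection_apply]

theorem FreeProdZ.transvection_mul_conj (g : G) :
    transvection g * MulAut.conj (Coprod.inl g) =
      MulAut.conj (Coprod.inr (FreeGroup.of ())) * transvection g *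
        (MulAut.conj (Coprod.inr (FreeGroup.of ())))⁻¹ :=
  MulEquiv.ext fun x => by simp [transvection_apply, mul_assoc]

theorem FreeProdZ.conj_inl_injective :
    Function.Injective fun g : G => MulAut.conj (Coprod.inl g : FreeProdZ G) := by
  refine (injective_iff_map_eq_one
    ((MulAut.conj : FreeProdZ G →* _).comp Coprod.inl)).2 fun g hg => ?_
  refine eq_one_of_commute (mul_inv_eq_iff_eq_mul.1 ?_)
  exact DFunLike.congr_fun hg (Coprod.inr (FreeGroup.of ()))

end Automorphisms

/-- If `G` is not nilpotent-by-abelian-by-finite, then `Aut(G * ℤ)` is not linear. -/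
theorem aut_coprod_int_not_linear (G : Type*) [Group G]
    (h : ¬ IsNilpotentByAbelianByFinite G) :
    ¬ IsLinear (MulAut (FreeProdZ G)) := by
  rintro ⟨K, _, n, f, hf⟩
  let ι : Matrix (Fin n) (Fin n) K →* Matrix (Fin n) (Fin n) (AlgebraicClosure K) :=
    (algebraMap K (AlgebraicClosure K)).mapMatrix.toMonoidHom
  have hι : Function.Injective ι :=
    Matrix.map_injective (algebraMap K (AlgebraicClosure K)).injective
  let F : MulAut (FreeProdZ G) →* Matrix (Fin n) (Fin n) (AlgebraicClosure K) :=
    (ι.comp (Units.coeHom _)).comp f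
  have hF : Function.Injective F := hι.comp (Units.val_injective.comp hf)
  refine h (isNilpotentByAbelianByFinite_of_commute (F.comp FreeProdZ.transvection)
    (F.comp (MulAut.conj.comp Monoid.Coprod.inl)) (hF.comp FreeProdZ.conj_inl_injective)
    (fun x y => (FreeProdZ.commute_transvection_conj x y).map F) fun g => ?_)
  set t : MulAut (FreeProdZ G) := MulAut.conj (Monoid.Coprod.inr (FreeGroup.of ())) with ht
  have h1 : F (FreeProdZ.transvection g) * F (MulAut.conj (Monoid.Coprod.inl g)) =
      F t * F (FreeProdZ.transvection g) * F t⁻¹ := by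
    rw [← map_mul, FreeProdZ.transvection_mul_conj, map_mul, map_mul]
  change (F (FreeProdZ.transvection g) * F (MulAut.conj (Monoid.Coprod.inl g))).charpoly = _
  rw [h1, Matrix.charpoly_mul_comm, ← mul_assoc, ← map_mul F, inv_mul_cancel, map_one, one_mul]
  rfl
end

section
/- Let F₃ be the free group with basis x₁, x₂, x₃ and let a₁, a₂, a₃ ∈ F₃ be elements such that the subgroup ⟨a₁, a₂, a₃⟩ is free of rank 3. Let αᵢ ∈ Aut(F₃) (i = 1,2,3) be conjugation by aᵢ, and let φ₁, φ₂ ∈ Aut(F₃) satisfy φ₁(a₁) = φ₂(a₁) = a₁, φ₁(a₂) = φ₂(a₂) = a₂, φ₁(a₃) = a₃a₁, φ₂(a₃) = a₃a₂. Then the subgroup of Aut(F₃) generated by α₁, α₂, α₃, φ₁, φ₂ is isomorphic to the poison group H(F₂). -/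
/-!
STATEMENT 8: Let `F₃` be free on `x₁,x₂,x₃` and `a₁,a₂,a₃ ∈ F₃` with
`⟨a₁,a₂,a₃⟩` free of rank 3 (i.e. `a₁,a₂,a₃` freely generate their span). Let
`αᵢ` be conjugation by `aᵢ` and `φ₁, φ₂ ∈ Aut(F₃)` with `φⱼ(a₁) = a₁`,
`φⱼ(a₂) = a₂`, `φ₁(a₃) = a₃a₁`, `φ₂(a₃) = a₃a₂`. Then
`⟨α₁, α₂, α₃, φ₁, φ₂⟩ ≤ Aut(F₃)` is isomorphic to the poison group `H(F₂)`.
-/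
variable (G : Type*) [Group G]

/-- The diagonal subgroup `{(g,g)} ≤ G × G`. -/
def diagSubgroup : Subgroup (G × G) where
  carrier := {p | p.1 = p.2}
  one_mem' := rfl
  mul_mem' := by
    intro a b (ha : a.1 = a.2) (hb : b.1 = b.2)
    show a.1 * b.1 = a.2 * b.2
    rw [ha, hb]
  inv_mem' := by
    intro a (ha : a.1 = a.2)
    show a.1⁻¹ = a.2⁻¹
    rw [ha]

/-- The subgroup `G × {1} ≤ G × G`. -/
def leftSubgroup : Subgroup (G × G) where
  carrier := {p | p.2 = 1}
  one_mem' := rfl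
  mul_mem' := by
    intro a b (ha : a.2 = 1) (hb : b.2 = 1)
    show a.2 * b.2 = 1
    rw [ha, hb, mul_one]
  inv_mem' := by
    intro a (ha : a.2 = 1)
    show a.2⁻¹ = 1
    rw [ha, inv_one]

/-- The isomorphism `(g,g) ↦ (g,1)` from the diagonal onto `G × {1}`. -/
def diagToLeft : diagSubgroup G ≃* leftSubgroup G where
  toFun x := ⟨(x.1.1, 1), rfl⟩
  invFun x := ⟨(x.1.1, x.1.1), rfl⟩
  left_inv := by
    rintro ⟨⟨a, b⟩, (h : a = b)⟩
    subst h
    rfl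
  right_inv := by
    rintro ⟨⟨a, b⟩, (h : b = 1)⟩
    subst h
    rfl
  map_mul' x y := by
    apply Subtype.ext
    show ((x*y).1.1, (1:G)) = (x.1.1 * y.1.1, 1*1)
    rw [mul_one]
    rfl

/-- The Formanek–Procesi group `H(G)`: the HNN extension of `G × G` with stable
letter `t` and the relations `t (g,g) t⁻¹ = (g,1)`. -/
def FPGroup : Type _ := HNNExtension (G × G) (diagSubgroup G) (leftSubgroup G) (diagToLeft G)

instance : Group (FPGroup G) := by delta FPGroup; infer_instance

/-- The free group of rank 3. -/
abbrev F3 : Type := FreeGroup (Fin 3)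

/-- The poison group `H(F₂)`. -/
abbrev PoisonGroup : Type := FPGroup (FreeGroup (Fin 2))

/-- An element of a free group commuting with two distinct basis elements is trivial. -/
theorem FreeGroup.eq_one_of_commute_of_of_s8 {ι : Type*} [DecidableEq ι] {i j : ι} (hij : i ≠ j)
    {n : FreeGroup ι} (hi : Commute n (FreeGroup.of i)) (hj : Commute n (FreeGroup.of j)) :
    n = 1 := by
  by_contra hn
  have key : ∀ c : ι, Commute n (FreeGroup.of c) → ∀ x ∈ n.toWord.head?, x.1 = c := by
    intro c hc x hx
    by_contra hxc
    obtain ⟨L, hL⟩ : ∃ L, n.toWord = x :: L := by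
      cases h : n.toWord with
      | nil => simp [h] at hx
      | cons y L => simp [h] at hx; exact ⟨L, by rw [hx]⟩
    have hleft : (FreeGroup.of c * n).toWord = (c, true) :: n.toWord := by
      rw [FreeGroup.toWord_mul, FreeGroup.toWord_of, List.singleton_append,
        FreeGroup.reduce.cons, FreeGroup.reduce_toWord, hL]
      have : c ≠ x.1 := fun h => hxc h.symm
      simp [this]
    have hsub : (n * FreeGroup.of c).toWord.Sublist (n.toWord ++ [(c, true)]) := by
      have := FreeGroup.toWord_mul_sublist n (FreeGroup.of c)
      rwa [FreeGroup.toWord_of] at this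
    rw [hc.eq, hleft] at hsub
    have heq := hsub.eq_of_length (by simp)
    rw [hL] at heq
    simp only [List.cons_append, List.cons.injEq] at heq
    exact hxc (by rw [← heq.1])
  cases h : n.toWord with
  | nil => exact hn (FreeGroup.toWord_eq_nil_iff.1 h)
  | cons x L =>
    exact hij ((key i hi x (by simp [h])).symm.trans (key j hj x (by simp [h])))

namespace PoisonGroup

/-- The embedding of the second factor of `F₂ × F₂`, together with the stable letter, as a map
from the free group of rank 3. -/
noncomputable def inner : F3 →* PoisonGroup :=
  FreeGroup.lift ![(HNNExtension.of (1, FreeGroup.of 0) : HNNExtension _ _ _ _),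
    (HNNExtension.of (1, FreeGroup.of 1) : HNNExtension _ _ _ _),
    (HNNExtension.t : HNNExtension _ _ _ _)]

/-- The canonical map from `F₂ × F₂`. -/
noncomputable def base : FreeGroup (Fin 2) × FreeGroup (Fin 2) →* PoisonGroup :=
  (HNNExtension.of : _ →* HNNExtension _ _ _ _)

/-- The stable letter. -/
noncomputable def stable : PoisonGroup := (HNNExtension.t : HNNExtension _ _ _ _)

@[simp] theorem inner_of_zero : inner (FreeGroup.of 0) = base (1, FreeGroup.of 0) := by
  simp [inner, base]; rfl

@[simp] theorem inner_of_one : inner (FreeGroup.of 1) = base (1, FreeGroup.of 1) := by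
  simp [inner, base]; rfl

@[simp] theorem inner_of_two : inner (FreeGroup.of 2) = stable := by
  simp [inner, stable]; rfl

theorem stable_mul_base (g : FreeGroup (Fin 2)) :
    stable * base (g, g) = base (g, 1) * stable :=
  HNNExtension.t_mul_of (φ := diagToLeft (FreeGroup (Fin 2))) ⟨(g, g), rfl⟩

@[elab_as_elim]
theorem induction_on {motive : PoisonGroup → Prop} (x : PoisonGroup)
    (base : ∀ g, motive (base g)) (stable : motive stable)
    (mul : ∀ x y, motive x → motive y → motive (x * y))
    (inv : ∀ x, motive x → motive x⁻¹) : motive x :=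
  HNNExtension.induction_on (φ := diagToLeft (FreeGroup (Fin 2))) x base stable mul inv

/-- The inclusion of `F₂` into `F₃` on the first two basis elements. -/
def incl : FreeGroup (Fin 2) →* F3 := FreeGroup.lift ![FreeGroup.of 0, FreeGroup.of 1]

theorem incl_eq_map : incl = FreeGroup.map Fin.castSucc := by
  ext i
  fin_cases i <;> simp [incl]

theorem incl_injective : Function.Injective incl := by
  rw [incl_eq_map]
  exact FreeGroup.map_injective (Fin.castSucc_injective 2)

@[simp] theorem inner_incl (h : FreeGroup (Fin 2)) : inner (incl h) = base (1, h) := by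
  have : inner.comp incl = base.comp (MonoidHom.inr _ _) := by
    ext i
    fin_cases i <;> simp [incl]
  exact DFunLike.congr_fun this h

theorem conj_inner_mem_range (q : FreeGroup (Fin 2)) (n : F3) :
    base (q, 1) * inner n * (base (q, 1))⁻¹ ∈ inner.range := by
  induction n using FreeGroup.induction_on with
  | C1 => simp
  | of i =>
    have hcomm (h) : base (q, 1) * base (1, h) * (base (q, 1))⁻¹ = base (1, h) := by
      rw [← map_mul, ← map_inv, ← map_mul]; simp
    fin_cases i
    · exact ⟨FreeGroup.of 0, by simp [hcomm]⟩
    · exact ⟨FreeGroup.of 1, by simp [hcomm]⟩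
    · refine ⟨FreeGroup.of 2 * incl q, ?_⟩
      have h : base (q, q) = base (1, q) * base (q, 1) := by rw [← map_mul]; simp
      change _ = base (q, 1) * inner (FreeGroup.of 2) * _
      rw [map_mul, inner_of_two, inner_incl, eq_mul_inv_iff_mul_eq, mul_assoc, ← h,
        stable_mul_base]
  | inv_of i ih => simpa [mul_assoc] using inv_mem ih
  | mul x y hx hy => simpa [mul_assoc] using mul_mem hx hy

theorem exists_eq_inner_mul_base (x : PoisonGroup) :
    ∃ (n : F3) (q : FreeGroup (Fin 2)), x = inner n * base (q, 1) := by
  induction x using induction_on with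
  | base g => exact ⟨incl g.2, g.1, by rw [inner_incl, ← map_mul]; simp⟩
  | stable => exact ⟨FreeGroup.of 2, 1, by simp [← Prod.one_eq_mk]⟩
  | mul x y hx hy =>
    obtain ⟨n, q, rfl⟩ := hx
    obtain ⟨m, r, rfl⟩ := hy
    obtain ⟨k, hk⟩ := conj_inner_mem_range q m
    have hqr : base (q * r, 1) = base (q, 1) * base (r, 1) := by rw [← map_mul]; simp
    exact ⟨n * k, q * r, by rw [map_mul, hk, hqr]; group⟩
  | inv x hx =>
    obtain ⟨n, q, rfl⟩ := hx
    obtain ⟨k, hk⟩ := conj_inner_mem_range q⁻¹ n⁻¹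
    have hq : base (q⁻¹, 1) = (base (q, 1))⁻¹ := by rw [← map_inv]; simp
    exact ⟨k, q⁻¹, by rw [hk, hq]; simp⟩

variable {F : Type*} [Group F] {a : Fin 3 → F} {Φ : FreeGroup (Fin 2) →* MulAut F}

/-- The automorphisms `Φ q` fix `a₁, a₂` and multiply `a₃` on the right by the image of `q`. -/
structure IsTransvection (a : Fin 3 → F) (Φ : FreeGroup (Fin 2) →* MulAut F) : Prop where
  apply_incl : ∀ q h, Φ q (FreeGroup.lift a (incl h)) = FreeGroup.lift a (incl h)
  apply_two : ∀ q, Φ q (a 2) = a 2 * FreeGroup.lift a (incl q)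

theorem isTransvection_lift (φ₁ φ₂ : MulAut F)
    (h11 : φ₁ (a 0) = a 0) (h21 : φ₂ (a 0) = a 0)
    (h12 : φ₁ (a 1) = a 1) (h22 : φ₂ (a 1) = a 1)
    (h13 : φ₁ (a 2) = a 2 * a 0) (h23 : φ₂ (a 2) = a 2 * a 1) :
    IsTransvection a (FreeGroup.lift ![φ₁, φ₂]) := by
  have fix : ∀ φ : MulAut F, φ (a 0) = a 0 → φ (a 1) = a 1 →
      ∀ h, φ (FreeGroup.lift a (incl h)) = FreeGroup.lift a (incl h) := by
    intro φ h0 h1 h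
    have : φ.toMonoidHom.comp ((FreeGroup.lift a).comp incl) = (FreeGroup.lift a).comp incl := by
      ext i
      fin_cases i <;> simp [incl, h0, h1]
    exact DFunLike.congr_fun this h
  have hincl : ∀ q h, FreeGroup.lift ![φ₁, φ₂] q (FreeGroup.lift a (incl h)) =
      FreeGroup.lift a (incl h) := by
    intro q h
    induction q using FreeGroup.induction_on with
    | C1 => simp
    | of i => fin_cases i <;> simp [fix φ₁ h11 h12, fix φ₂ h21 h22]
    | inv_of i ih =>
      apply (FreeGroup.lift ![φ₁, φ₂] (FreeGroup.of i)).injective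
      rw [ih, ← MulAut.mul_apply, ← map_mul]
      simp
    | mul x y hx hy => rw [map_mul, MulAut.mul_apply, hy, hx]
  refine ⟨hincl, fun q => ?_⟩
  induction q using FreeGroup.induction_on with
  | C1 => simp
  | of i => fin_cases i <;> simp [incl, *]
  | inv_of i ih =>
    apply (FreeGroup.lift ![φ₁, φ₂] (FreeGroup.of i)).injective
    rw [map_mul, ih, hincl, ← MulAut.mul_apply, ← map_mul]
    simp
  | mul x y hx hy => rw [map_mul, MulAut.mul_apply, hy, map_mul, hx, hincl]; simp [mul_assoc]

theorem mul_conj (φ : MulAut F) (g : F) :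
    φ * MulAut.conj g = MulAut.conj (φ g) * φ := by
  ext x
  simp

namespace IsTransvection

/-- The action of the poison group sending `(g, h)` to `Φ g` composed with conjugation by `h`,
and the stable letter to conjugation by `a₃`. -/
noncomputable def toMulAut (hΦ : IsTransvection a Φ) : PoisonGroup →* MulAut F :=
  HNNExtension.lift (φ := diagToLeft (FreeGroup (Fin 2)))
    (Φ.noncommCoprod (MulAut.conj.comp ((FreeGroup.lift a).comp incl)) fun q h => by
      simp [Commute, SemiconjBy, mul_conj, hΦ.apply_incl])
    (MulAut.conj (a 2)) (by
      rintro ⟨⟨g, h⟩, rfl : g = h⟩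
      change MulAut.conj (a 2) * (Φ g * MulAut.conj (FreeGroup.lift a (incl g))) =
        Φ g * MulAut.conj (FreeGroup.lift a (incl 1)) * MulAut.conj (a 2)
      rw [map_one, map_one, map_one, mul_one, mul_conj (Φ g), mul_conj (Φ g), hΦ.apply_two,
        hΦ.apply_incl, map_mul, mul_assoc])

variable (hΦ : IsTransvection a Φ)

theorem toMulAut_base (g h : FreeGroup (Fin 2)) :
    hΦ.toMulAut (base (g, h)) = Φ g * MulAut.conj (FreeGroup.lift a (incl h)) :=
  (HNNExtension.lift_of ..).trans rfl

theorem toMulAut_stable : hΦ.toMulAut stable = MulAut.conj (a 2) :=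
  HNNExtension.lift_t ..

theorem toMulAut_inner (n : F3) :
    hΦ.toMulAut (inner n) = MulAut.conj (FreeGroup.lift a n) := by
  have : hΦ.toMulAut.comp inner = MulAut.conj.comp (FreeGroup.lift a) := by
    ext1 i
    fin_cases i <;> simp [toMulAut_base, toMulAut_stable, incl]
  exact DFunLike.congr_fun this n

theorem toMulAut_injective (ha : Function.Injective (FreeGroup.lift a)) :
    Function.Injective hΦ.toMulAut := by
  rw [injective_iff_map_eq_one]
  intro x hx
  obtain ⟨n, q, rfl⟩ := exists_eq_inner_mul_base x
  have hact (y : F) : FreeGroup.lift a n * Φ q y * (FreeGroup.lift a n)⁻¹ = y := by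
    simpa [toMulAut_inner, toMulAut_base] using DFunLike.congr_fun hx y
  have hcomm (h) : Commute n (incl h) := ha <| by
    simpa [hΦ.apply_incl, mul_inv_eq_iff_eq_mul] using hact (FreeGroup.lift a (incl h))
  obtain rfl : n = 1 := FreeGroup.eq_one_of_commute_of_of_s8 (i := 0) (j := 1) (by decide)
    (by simpa [incl] using hcomm (FreeGroup.of 0)) (by simpa [incl] using hcomm (FreeGroup.of 1))
  obtain rfl : q = 1 := incl_injective <| ha <| by simpa [hΦ.apply_two] using hact (a 2)
  simp [← Prod.one_eq_mk]

theorem range_toMulAut : hΦ.toMulAut.range =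
    Subgroup.closure {MulAut.conj (a 0), MulAut.conj (a 1), MulAut.conj (a 2),
      Φ (FreeGroup.of 0), Φ (FreeGroup.of 1)} := by
  apply le_antisymm
  · rintro _ ⟨x, rfl⟩
    obtain ⟨n, q, rfl⟩ := exists_eq_inner_mul_base x
    rw [map_mul]
    refine mul_mem ?_ ?_
    · rw [toMulAut_inner]
      induction n using FreeGroup.induction_on with
      | C1 => simp
      | of i => fin_cases i <;> exact Subgroup.subset_closure (by simp)
      | inv_of i ih => simpa using ih
      | mul x y hx hy => rw [map_mul, map_mul]; exact mul_mem hx hy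
    · rw [toMulAut_base, map_one, map_one, map_one, mul_one]
      induction q using FreeGroup.induction_on with
      | C1 => simp
      | of i => fin_cases i <;> exact Subgroup.subset_closure (by simp)
      | inv_of i ih => simpa using ih
      | mul x y hx hy => rw [map_mul]; exact mul_mem hx hy
  · rw [Subgroup.closure_le]
    rintro _ (rfl | rfl | rfl | rfl | rfl)
    · exact ⟨inner (FreeGroup.of 0), by rw [toMulAut_inner]; simp⟩
    · exact ⟨inner (FreeGroup.of 1), by rw [toMulAut_inner]; simp⟩
    · exact ⟨inner (FreeGroup.of 2), by rw [toMulAut_inner]; simp⟩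
    · exact ⟨base (FreeGroup.of 0, 1), by simp [toMulAut_base]⟩
    · exact ⟨base (FreeGroup.of 1, 1), by simp [toMulAut_base]⟩

end IsTransvection

end PoisonGroup

theorem subgroup_iso_poison_group (a : Fin 3 → F3)
    (hfree : Function.Injective (FreeGroup.lift a : FreeGroup (Fin 3) →* F3))
    (φ₁ φ₂ : MulAut F3)
    (h11 : φ₁ (a 0) = a 0) (h21 : φ₂ (a 0) = a 0)
    (h12 : φ₁ (a 1) = a 1) (h22 : φ₂ (a 1) = a 1)
    (h13 : φ₁ (a 2) = a 2 * a 0) (h23 : φ₂ (a 2) = a 2 * a 1) :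
    Nonempty
      ((Subgroup.closure
          {MulAut.conj (a 0), MulAut.conj (a 1), MulAut.conj (a 2), φ₁, φ₂} :
            Subgroup (MulAut F3)) ≃* PoisonGroup) := by
  have hΦ := PoisonGroup.isTransvection_lift φ₁ φ₂ h11 h21 h12 h22 h13 h23
  have hrange := hΦ.range_toMulAut
  simp only [FreeGroup.lift_apply_of, Matrix.cons_val_zero, Matrix.cons_val_one] at hrange
  rw [← hrange]
  exact ⟨(MonoidHom.ofInjective (hΦ.toMulAut_injective hfree)).symm⟩
end

section
/- Let F₃ be the free group with basis x₁, x₂, x₃. Let a₁, a₂ be elements of the subgroup ⟨x₁, x₂⟩ that do not lie in a common cyclic subgroup, and set a₃ = x₃. Let αᵢ ∈ Aut(F₃) be conjugation by aᵢ (i = 1,2,3), and let φ₁, φ₂ ∈ Aut(F₃) be the automorphisms fixing x₁ and x₂ and sending x₃ ↦ x₃a₁ and x₃ ↦ x₃a₂, respectively. Then the subgroup of Aut(F₃) generated by α₁, α₂, α₃, φ₁, φ₂ is isomorphic to the poison group H(F₂). -/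
/-!
STATEMENT 9: Let `F₃` be free on `x₁,x₂,x₃`, let `a₁, a₂ ∈ ⟨x₁,x₂⟩` not lie in a
common cyclic subgroup, and let `a₃ = x₃`. Let `αᵢ` be conjugation by `aᵢ` and
let `φ₁, φ₂ ∈ Aut(F₃)` fix `x₁, x₂` and send `x₃ ↦ x₃a₁`, `x₃ ↦ x₃a₂`
respectively. Then `⟨α₁, α₂, α₃, φ₁, φ₂⟩ ≤ Aut(F₃)` is isomorphic to the poison
group `H(F₂)`.
-/
variable (G : Type*) [Group G]

universe u

/-- Free groups are residually finite. -/
theorem FreeGroup.exists_finite_monoidHom_apply_ne_one {α : Type u} (g : FreeGroup α)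
    (hg : g ≠ 1) : ∃ (Q : Type u) (_ : Group Q) (_ : Finite Q) (f : FreeGroup α →* Q), f g ≠ 1 := by
  classical
  let V : Set (FreeGroup α) := {v | ∃ L, L <:+ g.toWord ∧ v = FreeGroup.mk L}
  have hV : V.Finite := by
    refine ((g.toWord.tails.toFinset.finite_toSet).image FreeGroup.mk).subset ?_
    rintro _ ⟨L, hL, rfl⟩
    exact ⟨L, by simpa using hL, rfl⟩
  have := hV.fintype
  let e (x : α) : {v : V // FreeGroup.of x * v.1 ∈ V} ≃ {v : V // (FreeGroup.of x)⁻¹ * v.1 ∈ V} :=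
    { toFun := fun v => ⟨⟨FreeGroup.of x * v.1.1, v.2⟩, by simp⟩
      invFun := fun v => ⟨⟨(FreeGroup.of x)⁻¹ * v.1.1, v.2⟩, by simp⟩
      left_inv := fun v => by simp
      right_inv := fun v => by simp }
  let f : FreeGroup α →* Equiv.Perm V := FreeGroup.lift fun x => (e x).extendSubtype
  have hf (x : α) (v : V) (h : FreeGroup.of x * v.1 ∈ V) :
      (f (FreeGroup.of x) v).1 = FreeGroup.of x * v.1 := by
    simp only [f, FreeGroup.lift_apply_of]
    rw [(e x).extendSubtype_apply_of_mem v h]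
    rfl
  have one_mem : (1 : FreeGroup α) ∈ V := ⟨[], List.nil_suffix, rfl⟩
  have key (L : List (α × Bool)) (hL : L <:+ g.toWord) :
      (f (FreeGroup.mk L) ⟨1, one_mem⟩).1 = FreeGroup.mk L := by
    induction L with
    | nil => simp [← FreeGroup.one_eq_mk]
    | cons p L ih =>
      have hL' : L <:+ g.toWord := (List.suffix_cons p L).trans hL
      have hp : FreeGroup.mk (p :: L) = FreeGroup.mk [p] * FreeGroup.mk L := by simp
      have hmem : FreeGroup.mk [p] * FreeGroup.mk L ∈ V := ⟨p :: L, hL, hp.symm⟩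
      obtain ⟨v, hv⟩ : ∃ v : V, v.1 = FreeGroup.mk L := ⟨⟨_, L, hL', rfl⟩, rfl⟩
      rw [hp, f.map_mul, Equiv.Perm.mul_apply, Subtype.ext ((ih hL').trans hv.symm), ← hv]
      rw [← hv] at hmem
      obtain ⟨x, b⟩ := p
      cases b with
      | true => exact hf x v hmem
      | false =>
        have hx : (FreeGroup.mk [(x, false)] : FreeGroup α) = (FreeGroup.of x)⁻¹ := by
          simp [FreeGroup.of, FreeGroup.invRev]
        rw [hx] at hmem ⊢
        obtain ⟨w, hw⟩ : ∃ w : V, w.1 = (FreeGroup.of x)⁻¹ * v.1 := ⟨⟨_, hmem⟩, rfl⟩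
        have hwv : v.1 = FreeGroup.of x * w.1 := by simp [hw]
        have hfw : f (FreeGroup.of x) w = v := Subtype.ext <| by
          rw [hf x w (hwv ▸ v.2), hwv]
        rw [← hw, f.map_inv, ← hfw, Equiv.Perm.inv_def, Equiv.symm_apply_apply]
  refine ⟨Equiv.Perm V, inferInstance, inferInstance, f, fun h => hg ?_⟩
  have := key g.toWord List.suffix_rfl
  rw [FreeGroup.mk_toWord, h] at this
  exact this.symm

/-- Free groups of finite rank are Hopfian. -/
theorem FreeGroup.injective_of_surjective {α : Type u} [Finite α] (f : FreeGroup α →* FreeGroup α)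
    (hf : Function.Surjective f) : Function.Injective f := by
  rw [injective_iff_map_eq_one]
  intro g hg
  by_contra hne
  obtain ⟨Q, _, _, q, hq⟩ := exists_finite_monoidHom_apply_ne_one g hne
  have : Finite (FreeGroup α →* Q) := Finite.of_equiv _ (FreeGroup.lift (α := α) (β := Q))
  have hinj : Function.Injective fun k : FreeGroup α →* Q => k.comp f :=
    fun _ _ h => (MonoidHom.cancel_right hf).1 h
  obtain ⟨k, rfl⟩ := Finite.injective_iff_surjective.1 hinj q
  exact hq (by simp [hg])

theorem FreeGroup.exists_forall_mem_zpowers {α : Type*} [Subsingleton α] :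
    ∃ c : FreeGroup α, ∀ g, g ∈ Subgroup.zpowers c := by
  obtain h | ⟨⟨x⟩⟩ := isEmpty_or_nonempty α
  · exact ⟨1, fun g => by rw [Subsingleton.elim g 1]; exact one_mem _⟩
  · refine ⟨FreeGroup.of x, fun g => ?_⟩
    have : Subgroup.closure (Set.range (FreeGroup.of (α := α))) ≤
        Subgroup.zpowers (FreeGroup.of x) := by
      rw [Subgroup.closure_le]
      rintro _ ⟨y, rfl⟩
      rw [Subsingleton.elim y x]
      exact Subgroup.mem_zpowers _
    exact this (by rw [FreeGroup.closure_range_of]; trivial)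

/-- Two elements of a free group either lie in a common cyclic subgroup or freely generate a free
subgroup of rank two. -/
theorem IsFreeGroup.exists_mem_zpowers_or_injective_lift {G : Type*} [Group G] [IsFreeGroup G]
    (a b : G) : (∃ c : G, a ∈ Subgroup.zpowers c ∧ b ∈ Subgroup.zpowers c) ∨
      Function.Injective (FreeGroup.lift ![a, b]) := by
  classical
  let H := (FreeGroup.lift ![a, b]).range
  let e := IsFreeGroup.toFreeGroup H
  obtain h | ⟨x, y, hxy⟩ := subsingleton_or_nontrivial (IsFreeGroup.Generators H)
  · left
    obtain ⟨c, hc⟩ := FreeGroup.exists_forall_mem_zpowers (α := IsFreeGroup.Generators H)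
    have key (g : H) : (g : G) ∈ Subgroup.zpowers ((e.symm c : H) : G) := by
      obtain ⟨n, hn⟩ := hc (e g)
      have hg : e.symm c ^ n = g := by
        rw [← map_zpow, MulEquiv.symm_apply_eq]
        exact hn
      exact ⟨n, congrArg Subtype.val hg⟩
    exact ⟨_, key ⟨a, FreeGroup.of 0, by simp⟩, key ⟨b, FreeGroup.of 1, by simp⟩⟩
  · right
    let r : FreeGroup (IsFreeGroup.Generators H) →* FreeGroup (Fin 2) :=
      FreeGroup.map fun z => if z = x then 0 else 1
    have hr : Function.Surjective r := by
      refine FreeGroup.map_surjective fun i => ?_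
      fin_cases i
      · exact ⟨x, by simp⟩
      · exact ⟨y, by simp [hxy.symm]⟩
    have hsurj : Function.Surjective ((r.comp e.toMonoidHom).comp
        (FreeGroup.lift ![a, b]).rangeRestrict) :=
      (hr.comp e.surjective).comp (MonoidHom.rangeRestrict_surjective _)
    have hinj := FreeGroup.injective_of_surjective _ hsurj
    rw [MonoidHom.coe_comp] at hinj
    exact fun u v huv => hinj.of_comp (Subtype.ext huv)

theorem FreeGroup.exists_mem_zpowers_of_commute {α : Type*} {a b : FreeGroup α} (h : Commute a b) :
    ∃ c : FreeGroup α, a ∈ Subgroup.zpowers c ∧ b ∈ Subgroup.zpowers c := by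
  refine (IsFreeGroup.exists_mem_zpowers_or_injective_lift a b).resolve_right fun hinj => ?_
  have : (FreeGroup.of 0 * FreeGroup.of 1 : FreeGroup (Fin 2)) =
      FreeGroup.of 1 * FreeGroup.of 0 := hinj (by simpa using h.eq)
  exact absurd this (by decide)

theorem FreeGroup.mem_zpowers_of_commute_of {α : Type*} {x : α} {g : FreeGroup α}
    (h : Commute g (FreeGroup.of x)) : g ∈ Subgroup.zpowers (FreeGroup.of x) := by
  obtain ⟨c, hg, n, hn⟩ := exists_mem_zpowers_of_commute h
  have hn' : (FreeGroup.lift (fun _ : α => Multiplicative.ofAdd (1 : ℤ)) c).toAdd * n = 1 := by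
    simpa [mul_comm] using
      congrArg (fun z => (FreeGroup.lift (fun _ : α => Multiplicative.ofAdd (1 : ℤ)) z).toAdd) hn
  have hc : c ∈ Subgroup.zpowers (FreeGroup.of x) := by
    rw [← hn]
    obtain rfl | rfl := Int.isUnit_iff.1 (IsUnit.of_mul_eq_one_right _ hn')
    · simp
    · simp
  exact Subgroup.zpowers_le.2 hc hg

theorem FreeGroup.eq_one_of_commute_of {α : Type*} {x y : α} (hxy : x ≠ y) {g : FreeGroup α}
    (hx : Commute g (FreeGroup.of x)) (hy : Commute g (FreeGroup.of y)) : g = 1 := by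
  classical
  obtain ⟨m, rfl⟩ := mem_zpowers_of_commute_of hx
  obtain ⟨n, hn⟩ := mem_zpowers_of_commute_of hy
  have := congrArg (fun z => (FreeGroup.lift
    (Pi.mulSingle x (Multiplicative.ofAdd (1 : ℤ))) z).toAdd) hn
  simp [Pi.mulSingle_eq_of_ne hxy.symm] at this
  simp [← this]

theorem Monoid.CoprodI.lift_of_comp_injective {ι : Type*} {G H : ι → Type*} [∀ i, Group (G i)]
    [∀ i, Group (H i)] (f : ∀ i, G i →* H i) (hf : ∀ i, Function.Injective (f i)) :
    Function.Injective (lift fun i => (of (M := H) (i := i)).comp (f i)) := by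
  classical
  rw [injective_iff_map_eq_one]
  intro g hg
  let w := Word.equiv g
  let w' : Word H :=
    { toList := w.toList.map fun l => ⟨l.1, f l.1 l.2⟩
      ne_one := by
        intro l hl
        obtain ⟨k, hk, rfl⟩ := List.mem_map.1 hl
        exact (map_ne_one_iff _ (hf _)).2 (w.ne_one k hk)
      chain_ne := by
        rw [List.isChain_map]
        exact w.chain_ne }
  have hw : w.prod = g := Word.equiv.symm_apply_apply g
  have hw' : w'.prod = 1 := by
    rw [← hg, ← hw]
    simp [Word.prod, w', map_list_prod, Function.comp_def]
  have : w' = Word.empty := Word.equiv.symm.injective hw'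
  have : w.toList = [] := by simpa [w'] using congrArg Word.toList this
  rw [← hw, Word.prod, this]
  simp

theorem FreeGroup.injective_lift_of_mem_closure {a b : F3}
    (ha : a ∈ Subgroup.closure {FreeGroup.of (0 : Fin 3), FreeGroup.of 1})
    (hb : b ∈ Subgroup.closure {FreeGroup.of (0 : Fin 3), FreeGroup.of 1})
    (hab : Function.Injective (FreeGroup.lift ![a, b])) :
    Function.Injective (FreeGroup.lift ![a, b, FreeGroup.of 2]) := by
  let i (k : Bool) : FreeGroup (Fin 2) →* Monoid.CoprodI fun _ : Bool => FreeGroup (Fin 2) :=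
    Monoid.CoprodI.of (M := fun _ : Bool => FreeGroup (Fin 2)) (i := k)
  let j (k : Bool) : F3 →* Monoid.CoprodI fun _ : Bool => F3 :=
    Monoid.CoprodI.of (M := fun _ : Bool => F3) (i := k)
  let split : F3 →* Monoid.CoprodI fun _ : Bool => FreeGroup (Fin 2) :=
    FreeGroup.lift ![i false (FreeGroup.of 0), i false (FreeGroup.of 1), i true (FreeGroup.of 0)]
  have hsplit : Function.Injective split := by
    let r : (Monoid.CoprodI fun _ : Bool => FreeGroup (Fin 2)) →* F3 :=
      Monoid.CoprodI.lift fun k =>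
        bif k then FreeGroup.lift ![FreeGroup.of 2, 1]
        else FreeGroup.lift ![FreeGroup.of 0, FreeGroup.of 1]
    have hr : r.comp split = MonoidHom.id F3 := by
      ext x
      fin_cases x <;> simp [r, split, i]
    exact Function.LeftInverse.injective (g := r) fun x => DFunLike.congr_fun hr x
  let f (k : Bool) : FreeGroup (Fin 2) →* F3 :=
    bif k then FreeGroup.map ![2, 1] else FreeGroup.lift ![a, b]
  have hf (k : Bool) : Function.Injective (f k) := by
    cases k with
    | false => exact hab
    | true => exact FreeGroup.map_injective (by decide)
  let split' : F3 →* Monoid.CoprodI fun _ : Bool => F3 :=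
    FreeGroup.lift ![j false (FreeGroup.of 0), j false (FreeGroup.of 1), j true (FreeGroup.of 2)]
  have hsplit' : Set.EqOn split' (j false)
      (Subgroup.closure {FreeGroup.of (0 : Fin 3), FreeGroup.of 1}) := by
    refine MonoidHom.eqOn_closure ?_
    rintro _ (rfl | rfl) <;> simp [split']
  have hcomp : split'.comp (FreeGroup.lift ![a, b, FreeGroup.of 2]) =
      (Monoid.CoprodI.lift fun k => (j k).comp (f k)).comp split := by
    ext x
    fin_cases x
    · simpa [split, i, f] using hsplit' ha
    · simpa [split, i, f] using hsplit' hb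
    · simp [split, split', i, f]
  have hinj := (Monoid.CoprodI.lift_of_comp_injective f hf).comp hsplit
  refine Function.Injective.of_comp (f := split') ?_
  rw [← MonoidHom.coe_comp, hcomp]
  exact hinj

namespace PoisonGroup

open HNNExtension

/-- The poison group, unfolded as an HNN extension. -/
abbrev Ext : Type := HNNExtension (FreeGroup (Fin 2) × FreeGroup (Fin 2))
  (diagSubgroup (FreeGroup (Fin 2))) (leftSubgroup (FreeGroup (Fin 2)))
  (diagToLeft (FreeGroup (Fin 2)))

/-- The homomorphism from `F₃` onto the normal subgroup generated by the second factor and the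
stable letter. -/
def kernelHom : F3 →* PoisonGroup.Ext :=
  FreeGroup.lift ![of (1, FreeGroup.of 0), of (1, FreeGroup.of 1), t]

theorem of_one_mem_range_kernelHom (h : FreeGroup (Fin 2)) :
    (of (1, h) : PoisonGroup.Ext) ∈ kernelHom.range := by
  refine ⟨FreeGroup.map Fin.castSucc h, ?_⟩
  have : kernelHom.comp (FreeGroup.map Fin.castSucc) =
      (of : _ →* PoisonGroup.Ext).comp (MonoidHom.inr _ _) := by
    ext x
    fin_cases x <;> simp [kernelHom]
  exact DFunLike.congr_fun this h

theorem conj_kernelHom_mem_range (g : FreeGroup (Fin 2)) (w : F3) :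
    (of (g, 1) : PoisonGroup.Ext) * kernelHom w * (of (g, 1))⁻¹ ∈ kernelHom.range := by
  suffices Subgroup.closure (Set.range FreeGroup.of) ≤
      kernelHom.range.comap
        ((MulAut.conj (of (g, 1) : PoisonGroup.Ext)).toMonoidHom.comp kernelHom) from
    this (by rw [FreeGroup.closure_range_of]; trivial)
  rw [Subgroup.closure_le]
  have hcomm (h : FreeGroup (Fin 2)) :
      (of (g, 1) : PoisonGroup.Ext) * of (1, h) * (of (g, 1))⁻¹ = of (1, h) := by
    rw [← map_inv, ← map_mul, ← map_mul]
    simp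
  have ht : (of (g, 1) : PoisonGroup.Ext) * t * (of (g, 1))⁻¹ = t * of (1, g) := by
    have := t_mul_of (φ := diagToLeft (FreeGroup (Fin 2))) ⟨(g, g), rfl⟩
    rw [mul_inv_eq_iff_eq_mul, mul_assoc, ← map_mul]
    simpa [diagToLeft] using this.symm
  rintro _ ⟨x, rfl⟩
  fin_cases x
  · simpa [kernelHom, hcomm] using of_one_mem_range_kernelHom _
  · simpa [kernelHom, hcomm] using of_one_mem_range_kernelHom _
  · have htmem : (t : PoisonGroup.Ext) ∈ kernelHom.range := ⟨FreeGroup.of 2, by simp [kernelHom]⟩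
    have := mul_mem htmem (of_one_mem_range_kernelHom g)
    rw [← ht] at this
    simpa [kernelHom] using this

theorem exists_eq_kernelHom_mul_of (z : PoisonGroup.Ext) :
    ∃ (w : F3) (g : FreeGroup (Fin 2)), z = kernelHom w * of (g, 1) := by
  induction z using HNNExtension.induction_on with
  | of p =>
    obtain ⟨w, hw⟩ := of_one_mem_range_kernelHom p.2
    refine ⟨w, p.1, ?_⟩
    rw [hw, ← map_mul]
    simp
  | t => exact ⟨FreeGroup.of 2, 1, by
      rw [show ((1, 1) : FreeGroup (Fin 2) × FreeGroup (Fin 2)) = 1 from rfl]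
      simp [kernelHom]⟩
  | mul z z' hz hz' =>
    obtain ⟨w, g, rfl⟩ := hz
    obtain ⟨w', g', rfl⟩ := hz'
    obtain ⟨v, hv⟩ := conj_kernelHom_mem_range g w'
    refine ⟨w * v, g * g', ?_⟩
    rw [show (g * g', (1 : FreeGroup (Fin 2))) = (g, 1) * (g', 1) by simp, map_mul, map_mul, hv]
    group
  | inv z hz =>
    obtain ⟨w, g, rfl⟩ := hz
    obtain ⟨v, hv⟩ := conj_kernelHom_mem_range g⁻¹ w⁻¹
    refine ⟨v, g⁻¹, ?_⟩
    rw [hv, map_inv, mul_inv_rev, show (g⁻¹, (1 : FreeGroup (Fin 2))) = (g, 1)⁻¹ by simp, map_inv]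
    group

end PoisonGroup

theorem subgroup_iso_poison_group_concrete (a₁ a₂ : F3)
    (ha₁ : a₁ ∈ Subgroup.closure {FreeGroup.of (0 : Fin 3), FreeGroup.of 1})
    (ha₂ : a₂ ∈ Subgroup.closure {FreeGroup.of (0 : Fin 3), FreeGroup.of 1})
    (hcyc : ¬ ∃ c : F3, a₁ ∈ Subgroup.zpowers c ∧ a₂ ∈ Subgroup.zpowers c)
    (φ₁ φ₂ : MulAut F3)
    (h10 : φ₁ (FreeGroup.of 0) = FreeGroup.of 0)
    (h11 : φ₁ (FreeGroup.of 1) = FreeGroup.of 1)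
    (h12 : φ₁ (FreeGroup.of 2) = FreeGroup.of 2 * a₁)
    (h20 : φ₂ (FreeGroup.of 0) = FreeGroup.of 0)
    (h21 : φ₂ (FreeGroup.of 1) = FreeGroup.of 1)
    (h22 : φ₂ (FreeGroup.of 2) = FreeGroup.of 2 * a₂) :
    Nonempty
      ((Subgroup.closure
          {MulAut.conj a₁, MulAut.conj a₂, MulAut.conj (FreeGroup.of 2), φ₁, φ₂} :
            Subgroup (MulAut F3)) ≃* PoisonGroup) := by
  let S : Subgroup F3 := Subgroup.closure {FreeGroup.of (0 : Fin 3), FreeGroup.of 1}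
  let ρ : FreeGroup (Fin 2) →* F3 := FreeGroup.lift ![a₁, a₂]
  let σ : F3 →* F3 := FreeGroup.lift ![a₁, a₂, FreeGroup.of 2]
  let Φ : FreeGroup (Fin 2) →* MulAut F3 := FreeGroup.lift ![φ₁, φ₂]
  have hρ : Function.Injective ρ :=
    (IsFreeGroup.exists_mem_zpowers_or_injective_lift a₁ a₂).resolve_left hcyc
  have hσ : Function.Injective σ := FreeGroup.injective_lift_of_mem_closure ha₁ ha₂ hρ
  have hρS (g : FreeGroup (Fin 2)) : ρ g ∈ S := by
    have : ρ.range ≤ S := by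
      rw [FreeGroup.range_lift_eq_closure, Subgroup.closure_le]
      rintro _ ⟨x, rfl⟩
      fin_cases x
      · exact ha₁
      · exact ha₂
    exact this ⟨g, rfl⟩
  have hΦgen (g : FreeGroup (Fin 2)) :
      Φ g (FreeGroup.of 0) = FreeGroup.of 0 ∧ Φ g (FreeGroup.of 1) = FreeGroup.of 1 := by
    have : Φ.range ≤ MulAction.stabilizer (MulAut F3) (FreeGroup.of (0 : Fin 3)) ⊓
        MulAction.stabilizer (MulAut F3) (FreeGroup.of (1 : Fin 3)) := by
      rw [FreeGroup.range_lift_eq_closure, Subgroup.closure_le]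
      rintro _ ⟨x, rfl⟩
      fin_cases x
      · exact ⟨h10, h11⟩
      · exact ⟨h20, h21⟩
    exact this ⟨g, rfl⟩
  have hΦS (g : FreeGroup (Fin 2)) {s : F3} (hs : s ∈ S) : Φ g s = s := by
    have : Set.EqOn (Φ g).toMonoidHom (MonoidHom.id F3) S := by
      refine MonoidHom.eqOn_closure ?_
      rintro _ (rfl | rfl)
      · exact (hΦgen g).1
      · exact (hΦgen g).2
    exact this hs
  have hΦ2 (g : FreeGroup (Fin 2)) : Φ g (FreeGroup.of 2) = FreeGroup.of 2 * ρ g := by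
    have hgen (x : Fin 2) : Φ (FreeGroup.of x) (FreeGroup.of 2) =
        FreeGroup.of 2 * ρ (FreeGroup.of x) := by
      fin_cases x
      · simpa [Φ, ρ] using h12
      · simpa [Φ, ρ] using h22
    induction g using FreeGroup.induction_on with
    | C1 => simp
    | of x => exact hgen x
    | inv_of x _ =>
      rw [map_inv, MulAut.inv_apply, MulEquiv.symm_apply_eq, map_mul, hgen,
        hΦS _ (hρS _), map_inv, mul_inv_cancel_right]
    | mul g h hg hh =>
      rw [map_mul, MulAut.mul_apply, hh, map_mul, hg, hΦS g (hρS h), map_mul, mul_assoc]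
  have hconj (g : FreeGroup (Fin 2)) (s : F3) :
      Φ g * MulAut.conj s = MulAut.conj (Φ g s) * Φ g := by
    ext x : 1
    simp
  let f : FreeGroup (Fin 2) × FreeGroup (Fin 2) →* MulAut F3 :=
    Φ.noncommCoprod (MulAut.conj.comp ρ) fun g h => by
      have := hconj g (ρ h)
      rwa [hΦS g (hρS h)] at this
  have hf (p : FreeGroup (Fin 2) × FreeGroup (Fin 2)) : f p = Φ p.1 * MulAut.conj (ρ p.2) := rfl
  let Ψ : PoisonGroup.Ext →* MulAut F3 :=
    HNNExtension.lift f (MulAut.conj (FreeGroup.of 2)) <| by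
      rintro ⟨⟨g, h⟩, rfl : g = h⟩
      have h₂ : f (diagToLeft _ ⟨(g, g), rfl⟩ : _ × _) = Φ g := by
        simp [hf, diagToLeft]
      rw [hf, h₂, hconj, hconj, hΦ2, hΦS g (hρS g), map_mul, mul_assoc]
  have hΨof (g : FreeGroup (Fin 2)) : Ψ (HNNExtension.of (g, 1)) = Φ g := by
    simp [Ψ, hf]
  have hΨker (w : F3) : Ψ (PoisonGroup.kernelHom w) = MulAut.conj (σ w) := by
    have : Ψ.comp PoisonGroup.kernelHom = MulAut.conj.comp σ := by
      ext x : 1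
      fin_cases x <;> simp [Ψ, hf, σ, ρ, PoisonGroup.kernelHom]
    exact DFunLike.congr_fun this w
  have hinj : Function.Injective Ψ := by
    rw [injective_iff_map_eq_one]
    intro z hz
    obtain ⟨w, g, rfl⟩ := PoisonGroup.exists_eq_kernelHom_mul_of z
    rw [map_mul, hΨker, hΨof] at hz
    have happ (s : F3) : σ w * Φ g s * (σ w)⁻¹ = s := DFunLike.congr_fun hz s
    have hcomm (s : F3) (hs : Φ g s = s) : Commute (σ w) s := by
      have := happ s
      rwa [hs, mul_inv_eq_iff_eq_mul] at this
    have hσw : σ w = 1 := FreeGroup.eq_one_of_commute_of (by decide)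
      (hcomm _ (hΦgen g).1) (hcomm _ (hΦgen g).2)
    have hρg : ρ g = 1 := by
      simpa [hσw, hΦ2] using happ (FreeGroup.of 2)
    rw [(map_eq_one_iff σ hσ).1 hσw, (map_eq_one_iff ρ hρ).1 hρg, map_one, one_mul]
    exact map_one HNNExtension.of
  have hrange : Subgroup.closure
      {MulAut.conj a₁, MulAut.conj a₂, MulAut.conj (FreeGroup.of 2), φ₁, φ₂} = Ψ.range := by
    apply le_antisymm
    · rw [Subgroup.closure_le]
      rintro _ (rfl | rfl | rfl | rfl | rfl)
      · exact ⟨_, (hΨker (FreeGroup.of 0)).trans (by simp [σ])⟩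
      · exact ⟨_, (hΨker (FreeGroup.of 1)).trans (by simp [σ])⟩
      · exact ⟨_, (hΨker (FreeGroup.of 2)).trans (by simp [σ])⟩
      · exact ⟨_, (hΨof (FreeGroup.of 0)).trans (by simp [Φ])⟩
      · exact ⟨_, (hΨof (FreeGroup.of 1)).trans (by simp [Φ])⟩
    · rintro _ ⟨z, rfl⟩
      obtain ⟨w, g, rfl⟩ := PoisonGroup.exists_eq_kernelHom_mul_of z
      rw [map_mul, hΨker, hΨof]
      refine mul_mem ?_ ?_
      · have : (MulAut.conj.comp σ).range ≤ Subgroup.closure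
            {MulAut.conj a₁, MulAut.conj a₂, MulAut.conj (FreeGroup.of 2), φ₁, φ₂} := by
          rw [MonoidHom.range_comp, FreeGroup.range_lift_eq_closure, MonoidHom.map_closure]
          refine Subgroup.closure_mono ?_
          rintro _ ⟨_, ⟨x, rfl⟩, rfl⟩
          fin_cases x <;> simp
        exact this ⟨w, rfl⟩
      · have : Φ.range ≤ Subgroup.closure
            {MulAut.conj a₁, MulAut.conj a₂, MulAut.conj (FreeGroup.of 2), φ₁, φ₂} := by
          rw [FreeGroup.range_lift_eq_closure]
          refine Subgroup.closure_mono ?_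
          rintro _ ⟨x, rfl⟩
          fin_cases x <;> simp
        exact this ⟨g, rfl⟩
  exact ⟨(MulEquiv.subgroupCongr hrange).trans (MonoidHom.ofInjective hinj).symm⟩
end
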